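/- Let 1 < s + α ≤ 1 + Q/p with Q/(Q+s) < p < ∞, and assume the measure lower bound μ(B(x,r)) ≥ c_l r^Q. Then there exists C > 0 such that ‖M*_α u‖_{Ṁ^{1,q}(X)} ≤ C ‖u‖_{Ṁ^{s,p}(X)}, where q = Qp/(Q - (s+α-1)p), for all u ∈ Ṁ^{s,p}(X) with M*_α u not identically infinite. -/

import Mathlib

open MeasureTheory Metric ENNReal

namespace FracMaximal

variable {X : Type*}

/-- The measure `μ` is doubling with constant `c`. -/
def IsDoubling [PseudoMetricSpace X] [MeasurableSpace X] (μ : Measure X) (c : ℝ≥0∞) : Prop :=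
  ∀ (x : X) (r : ℝ), 0 < r → μ (ball x (2 * r)) ≤ c * μ (ball x r)

/-- Lower dimension bound: `μ(B(y,r))/μ(B(x,R)) ≥ c (r/R)^Q`. -/
def DimLowerBound [PseudoMetricSpace X] [MeasurableSpace X] (μ : Measure X) (c Q : ℝ) : Prop :=
  ∀ (x y : X) (r R : ℝ), 0 < r → r ≤ R → y ∈ ball x R →
    ENNReal.ofReal (c * (r / R) ^ Q) * μ (ball x R) ≤ μ (ball y r)

/-- The fractional maximal function `M_α u(x) = sup_{r>0} r^α ⨍_{B(x,r)} |u| dμ`. -/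
noncomputable def fracMax [PseudoMetricSpace X] [MeasurableSpace X] (μ : Measure X) (α : ℝ)
    (u : X → ℝ) (x : X) : ℝ≥0∞ :=
  ⨆ (r : ℝ) (_ : 0 < r), ENNReal.ofReal (r ^ α) * ⨍⁻ y in ball x r, ‖u y‖₊ ∂μ

/-- `g` is an `s`-Hajłasz gradient of `u`. -/
def IsHajlaszGradient [PseudoMetricSpace X] [MeasurableSpace X] (μ : Measure X) (s : ℝ)
    (u g : X → ℝ) : Prop :=
  Measurable g ∧ (∀ x, 0 ≤ g x) ∧ ∃ E : Set X, μ E = 0 ∧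
    ∀ x ∉ E, ∀ y ∉ E, |u x - u y| ≤ dist x y ^ s * (g x + g y)

/-- The homogeneous Hajłasz space (quasi)norm `‖u‖_{Ṁ^{s,p}}`. -/
noncomputable def hajlaszNorm [PseudoMetricSpace X] [MeasurableSpace X] (μ : Measure X)
    (s p : ℝ) (u : X → ℝ) : ℝ≥0∞ :=
  ⨅ (g : X → ℝ) (_ : IsHajlaszGradient μ s u g), eLpNorm g (ENNReal.ofReal p) μ

/-- `(g k)` is a fractional `s`-Hajłasz gradient of `u`. -/
def IsFracHajlaszGradient [PseudoMetricSpace X] [MeasurableSpace X] (μ : Measure X) (s : ℝ)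
    (u : X → ℝ) (g : ℤ → X → ℝ) : Prop :=
  (∀ k, Measurable (g k)) ∧ (∀ k x, 0 ≤ g k x) ∧ ∃ E : Set X, μ E = 0 ∧
    ∀ (k : ℤ), ∀ x ∉ E, ∀ y ∉ E,
      (2 : ℝ) ^ (-k - 1) ≤ dist x y → dist x y < (2 : ℝ) ^ (-k) →
        |u x - u y| ≤ dist x y ^ s * (g k x + g k y)

/-- Homogeneous Hajłasz--Triebel--Lizorkin (quasi)norm `‖u‖_{Ṁ^s_{p,q}}`. -/
noncomputable def tlNorm [PseudoMetricSpace X] [MeasurableSpace X] (μ : Measure X)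
    (s p q : ℝ) (u : X → ℝ) : ℝ≥0∞ :=
  ⨅ (g : ℤ → X → ℝ) (_ : IsFracHajlaszGradient μ s u g),
    (∫⁻ x, (∑' k : ℤ, ENNReal.ofReal (g k x ^ q)) ^ (p / q) ∂μ) ^ (1 / p)

/-- Homogeneous Hajłasz--Besov (quasi)norm `‖u‖_{Ṅ^s_{p,q}}`. -/
noncomputable def besovNorm [PseudoMetricSpace X] [MeasurableSpace X] (μ : Measure X)
    (s p q : ℝ) (u : X → ℝ) : ℝ≥0∞ :=
  ⨅ (g : ℤ → X → ℝ) (_ : IsFracHajlaszGradient μ s u g),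
    (∑' k : ℤ, (eLpNorm (g k) (ENNReal.ofReal p) μ) ^ q) ^ (1 / q)

/-- Data for the discrete (fractional) maximal operator: for each positive rational scale `r`,
a covering of `X` by balls `B(x_i, r)` whose dilations `B(x_i, 6r)` have bounded overlap,
together with a Lipschitz partition of unity subordinate to the covering. -/
structure DiscreteMaxData (X : Type*) [PseudoMetricSpace X] where
  center : ℚ → ℕ → X
  φ : ℚ → ℕ → X → ℝ
  N : ℕ
  ν : ℝ
  L : ℝ
  ν_pos : 0 < ν
  L_pos : 0 < L
  cover : ∀ r : ℚ, 0 < r → ∀ x : X, ∃ i, x ∈ ball (center r i) (r : ℝ)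
  overlap : ∀ r : ℚ, 0 < r → ∀ x : X,
    ∑' i : ℕ, (ball (center r i) (6 * (r : ℝ))).indicator (fun _ => (1 : ℝ≥0∞)) x ≤ N
  φ_nonneg : ∀ r i x, 0 ≤ φ r i x
  φ_le_one : ∀ r i x, φ r i x ≤ 1
  φ_supp : ∀ r : ℚ, 0 < r → ∀ i x, x ∉ ball (center r i) (6 * (r : ℝ)) → φ r i x = 0
  φ_lower : ∀ r : ℚ, 0 < r → ∀ i x, x ∈ ball (center r i) (3 * (r : ℝ)) → ν ≤ φ r i x
  φ_lip : ∀ r : ℚ, 0 < r → ∀ i, LipschitzWith (Real.toNNReal (L / (r : ℝ))) (φ r i)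
  φ_sum : ∀ r : ℚ, 0 < r → ∀ x, ∑' i, φ r i x = 1

/-- The discrete fractional maximal function `M*_α u = sup_j r_j^α |u|_{r_j}`, where
`|u|_r(x) = Σ_i φ_i(x) ⨍_{B(x_i,3r)} |u| dμ` is the discrete convolution at scale `3r`. -/
noncomputable def DiscreteMaxData.dMax [PseudoMetricSpace X] [MeasurableSpace X]
    (D : DiscreteMaxData X) (μ : Measure X) (α : ℝ) (u : X → ℝ) (x : X) : ℝ≥0∞ :=
  ⨆ (r : ℚ) (_ : 0 < r), ENNReal.ofReal ((r : ℝ) ^ α) *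
    ∑' i : ℕ, ENNReal.ofReal (D.φ r i x) *
      ⨍⁻ y in ball (D.center r i) (3 * (r : ℝ)), ‖u y‖₊ ∂μ

section Averages

variable [MetricSpace X] [MeasurableSpace X] {μ : Measure X} {Q c_Q : ℝ}

/-- Under the lower dimension bound, comparable balls have comparable measures. -/
lemma DimLowerBound.measure_ball_le (hdim : DimLowerBound μ c_Q Q) (hcQ : 0 < c_Q) (hQ : 0 ≤ Q)
    {x y : X} {r R κ : ℝ} (hr : 0 < r) (hrR : r ≤ R) (hR : R ≤ κ * r) (hy : y ∈ ball x R) :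
    μ (ball x R) ≤ ENNReal.ofReal (c_Q⁻¹ * κ ^ Q) * μ (ball y r) := by
  have hRpos : 0 < R := hr.trans_le hrR
  have hκ : 0 < κ := pos_of_mul_pos_left (hRpos.trans_le hR) hr.le
  have h := hdim x y r R hr hrR hy
  have h1 : κ⁻¹ ≤ r / R := by
    rw [inv_eq_one_div, div_le_div_iff₀ hκ hRpos]; linarith
  have h2 : c_Q * (κ ^ Q)⁻¹ ≤ c_Q * (r / R) ^ Q := by
    rw [← Real.inv_rpow hκ.le]
    exact mul_le_mul_of_nonneg_left (Real.rpow_le_rpow (by positivity) h1 hQ) hcQ.le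
  calc μ (ball x R)
      = ENNReal.ofReal (c_Q⁻¹ * κ ^ Q) *
          (ENNReal.ofReal (c_Q * (κ ^ Q)⁻¹) * μ (ball x R)) := by
        rw [← mul_assoc, ← ENNReal.ofReal_mul (by positivity)]
        have : c_Q⁻¹ * κ ^ Q * (c_Q * (κ ^ Q)⁻¹) = 1 := by
          have : κ ^ Q ≠ 0 := by positivity
          field_simp
        rw [this, ENNReal.ofReal_one, one_mul]
    _ ≤ ENNReal.ofReal (c_Q⁻¹ * κ ^ Q) *
          (ENNReal.ofReal (c_Q * (r / R) ^ Q) * μ (ball x R)) := by gcongr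
    _ ≤ _ := by gcongr

/-- If `u` is close to the constant `c` in mean on a ball, then the mean of `|u|` over every
comparable ball inside it is close to `|c|`. -/
lemma abs_laverage_sub_abs_le (hdim : DimLowerBound μ c_Q Q) (hcQ : 0 < c_Q) (hQ : 0 ≤ Q)
    (hpos : ∀ (x : X) (r : ℝ), 0 < r → μ (ball x r) ≠ 0)
    (hfin : ∀ (x : X) (r : ℝ), μ (ball x r) ≠ ⊤)
    {u : X → ℝ} (hu : AEStronglyMeasurable u μ) {x z : X} {R ρ κ c ω : ℝ} (hω : 0 ≤ ω)
    (hosc : ∫⁻ y in ball x R, ‖u y - c‖ₑ ∂μ ≤ ENNReal.ofReal ω * μ (ball x R))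
    (hρ : 0 < ρ) (hzR : dist z x + ρ ≤ R) (hR : R ≤ κ * ρ) :
    ⨍⁻ y in ball z ρ, ‖u y‖₊ ∂μ ≠ ⊤ ∧
      |(⨍⁻ y in ball z ρ, ‖u y‖₊ ∂μ).toReal - abs c| ≤ c_Q⁻¹ * κ ^ Q * ω := by
  have hκ : 0 < κ := by
    have : 0 < R := by linarith [dist_nonneg (x := z) (y := x)]
    exact pos_of_mul_pos_left (this.trans_le hR) hρ.le
  set W : ℝ := c_Q⁻¹ * κ ^ Q * ω with hW
  have hW0 : 0 ≤ W := by positivity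
  set m := μ (ball z ρ) with hm
  have hm0 : m ≠ 0 := hpos z ρ hρ
  have hmt : m ≠ ⊤ := hfin z ρ
  have hsub : ball z ρ ⊆ ball x R := ball_subset_ball' (by linarith)
  have hosc' : ∫⁻ y in ball z ρ, ‖u y - c‖ₑ ∂μ ≤ ENNReal.ofReal W * m := by
    calc ∫⁻ y in ball z ρ, ‖u y - c‖ₑ ∂μ
        ≤ ∫⁻ y in ball x R, ‖u y - c‖ₑ ∂μ := lintegral_mono_set hsub
      _ ≤ ENNReal.ofReal ω * μ (ball x R) := hosc
      _ ≤ ENNReal.ofReal ω * (ENNReal.ofReal (c_Q⁻¹ * κ ^ Q) * m) := by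
          gcongr
          exact hdim.measure_ball_le hcQ hQ hρ (by linarith [dist_nonneg (x := z) (y := x)]) hR
            (by rw [mem_ball]; linarith)
      _ = ENNReal.ofReal W * m := by
          rw [← mul_assoc, ← ENNReal.ofReal_mul hω, hW, mul_comm ω]
  set A := ⨍⁻ y in ball z ρ, (‖u y‖₊ : ℝ≥0∞) ∂μ with hA
  have hAm : A * m = ∫⁻ y in ball z ρ, ‖u y‖ₑ ∂μ := by
    rw [hA, setLAverage_eq, ENNReal.div_mul_cancel hm0 hmt]; rfl
  have hconst : ∫⁻ _ in ball z ρ, ‖c‖ₑ ∂μ = ‖c‖ₑ * m := by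
    rw [lintegral_const, Measure.restrict_apply_univ]
  have hup : A ≤ ENNReal.ofReal W + ‖c‖ₑ := by
    refine (ENNReal.mul_le_mul_iff_left hm0 hmt).1 ?_
    rw [hAm, add_mul, ← hconst]
    calc ∫⁻ y in ball z ρ, ‖u y‖ₑ ∂μ
        ≤ ∫⁻ y in ball z ρ, (‖u y - c‖ₑ + ‖c‖ₑ) ∂μ := by
          refine lintegral_mono fun y => ?_
          simpa using enorm_add_le (u y - c) c
      _ = ∫⁻ y in ball z ρ, ‖u y - c‖ₑ ∂μ + ∫⁻ _ in ball z ρ, ‖c‖ₑ ∂μ :=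
          lintegral_add_right _ measurable_const
      _ ≤ _ := by gcongr
  have hlo : ‖c‖ₑ ≤ A + ENNReal.ofReal W := by
    refine (ENNReal.mul_le_mul_iff_left hm0 hmt).1 ?_
    rw [add_mul, hAm, ← hconst]
    calc ∫⁻ y in ball z ρ, ‖c‖ₑ ∂μ
        ≤ ∫⁻ y in ball z ρ, (‖u y‖ₑ + ‖u y - c‖ₑ) ∂μ := by
          refine lintegral_mono fun y => ?_
          simpa using enorm_sub_le (E := ℝ) (a := u y) (b := u y - c)
      _ = ∫⁻ y in ball z ρ, ‖u y‖ₑ ∂μ + ∫⁻ y in ball z ρ, ‖u y - c‖ₑ ∂μ :=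
          lintegral_add_left' hu.restrict.enorm _
      _ ≤ _ := by gcongr
  rw [Real.enorm_eq_ofReal_abs] at hup hlo
  have hAt : A ≠ ⊤ := ne_top_of_le_ne_top (by simp) hup
  refine ⟨hAt, ?_⟩
  rw [← ENNReal.ofReal_add hW0 (abs_nonneg c)] at hup
  have h1 := ENNReal.toReal_le_of_le_ofReal (by positivity) hup
  rw [← ENNReal.ofReal_toReal hAt, ← ENNReal.ofReal_add ENNReal.toReal_nonneg hW0] at hlo
  have h2 := (ENNReal.ofReal_le_ofReal_iff (by positivity)).1 hlo
  rw [abs_le]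
  constructor <;> linarith

end Averages

section PartitionOfUnity

variable [PseudoMetricSpace X] (D : DiscreteMaxData X)

/-- At each point and scale, at most `N` of the functions `φ r i` are nonzero. -/
lemma DiscreteMaxData.exists_finset_support {r : ℚ} (hr : 0 < r) (x : X) :
    ∃ I : Finset ℕ, I.card ≤ D.N ∧ (∀ i ∉ I, D.φ r i x = 0) ∧
      ∀ i ∈ I, dist (D.center r i) x < 6 * (r : ℝ) := by
  obtain ⟨hf, hcard⟩ := ENNReal.finset_card_const_le_le_of_tsum_le
    (ENNReal.natCast_ne_top D.N) (D.overlap r hr x) one_ne_zero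
  have hmem : ∀ i, i ∈ hf.toFinset ↔ x ∈ ball (D.center r i) (6 * (r : ℝ)) := by
    intro i
    by_cases h : x ∈ ball (D.center r i) (6 * (r : ℝ)) <;> simp [h]
  refine ⟨hf.toFinset, ?_, fun i hi => ?_, fun i hi => ?_⟩
  · rw [div_one] at hcard
    exact_mod_cast hcard
  · exact D.φ_supp r hr i x fun h => hi ((hmem i).2 h)
  · rw [dist_comm]
    exact (hmem i).1 hi

lemma DiscreteMaxData.sum_φ_eq_one {r : ℚ} (hr : 0 < r) {x : X} {I : Finset ℕ}
    (hI : ∀ i ∉ I, D.φ r i x = 0) : ∑ i ∈ I, D.φ r i x = 1 := by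
  rw [← D.φ_sum r hr x, tsum_eq_sum hI]

lemma DiscreteMaxData.tsum_φ_mul_eq_ofReal (r : ℚ) {x : X} {I : Finset ℕ}
    (hI : ∀ i ∉ I, D.φ r i x = 0) {A : ℕ → ℝ≥0∞} (hA : ∀ i ∈ I, A i ≠ ⊤) :
    ∑' i, ENNReal.ofReal (D.φ r i x) * A i =
      ENNReal.ofReal (∑ i ∈ I, D.φ r i x * (A i).toReal) := by
  rw [tsum_eq_sum (s := I) fun i hi => by simp [hI i hi],
    ENNReal.ofReal_sum_of_nonneg fun i _ => mul_nonneg (D.φ_nonneg r i x) ENNReal.toReal_nonneg]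
  refine Finset.sum_congr rfl fun i hi => ?_
  rw [ENNReal.ofReal_mul (D.φ_nonneg r i x), ENNReal.ofReal_toReal (hA i hi)]

/-- Two discrete convolutions with almost constant coefficients differ little. -/
lemma DiscreteMaxData.abs_sum_φ_sub_sum_φ_le {r : ℚ} (hr : 0 < r) {x y : X} {I : Finset ℕ}
    (hIx : ∀ i ∉ I, D.φ r i x = 0) (hIy : ∀ i ∉ I, D.φ r i y = 0) {a : ℕ → ℝ} {c ω : ℝ}
    (ha : ∀ i ∈ I, |a i - c| ≤ ω) :
    |∑ i ∈ I, D.φ r i x * a i - ∑ i ∈ I, D.φ r i y * a i| ≤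
      I.card * (D.L / r * dist x y * ω) := by
  have hr' : (0 : ℝ) < r := by exact_mod_cast hr
  have h : ∑ i ∈ I, D.φ r i x * a i - ∑ i ∈ I, D.φ r i y * a i =
      ∑ i ∈ I, (D.φ r i x - D.φ r i y) * (a i - c) := by
    have hx := D.sum_φ_eq_one hr hIx
    have hy := D.sum_φ_eq_one hr hIy
    simp only [sub_mul, mul_sub, Finset.sum_sub_distrib, ← Finset.sum_mul, hx, hy]
    ring
  rw [h, ← nsmul_eq_mul]
  refine (Finset.abs_sum_le_sum_abs _ _).trans (Finset.sum_le_card_nsmul _ _ _ fun i hi => ?_)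
  have hlip := (D.φ_lip r hr i).dist_le_mul x y
  rw [Real.coe_toNNReal _ (div_pos D.L_pos hr').le, Real.dist_eq] at hlip
  rw [abs_mul]
  exact mul_le_mul hlip (ha i hi) (abs_nonneg _) (by have := D.L_pos; positivity)

lemma DiscreteMaxData.abs_sum_φ_sub_le {r : ℚ} (hr : 0 < r) {x : X} {I : Finset ℕ}
    (hI : ∀ i ∉ I, D.φ r i x = 0) {a : ℕ → ℝ} {c ω : ℝ}
    (ha : ∀ i ∈ I, |a i - c| ≤ ω) : |∑ i ∈ I, D.φ r i x * a i - c| ≤ ω := by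
  have hsum := D.sum_φ_eq_one hr hI
  have h : ∑ i ∈ I, D.φ r i x * a i - c = ∑ i ∈ I, D.φ r i x * (a i - c) := by
    simp only [mul_sub, Finset.sum_sub_distrib, ← Finset.sum_mul, hsum, one_mul]
  rw [h]
  calc |∑ i ∈ I, D.φ r i x * (a i - c)|
      ≤ ∑ i ∈ I, D.φ r i x * ω := by
        refine (Finset.abs_sum_le_sum_abs _ _).trans (Finset.sum_le_sum fun i hi => ?_)
        rw [abs_mul, abs_of_nonneg (D.φ_nonneg r i x)]
        exact mul_le_mul_of_nonneg_left (ha i hi) (D.φ_nonneg r i x)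
    _ = ω := by rw [← Finset.sum_mul, hsum, one_mul]

end PartitionOfUnity

/-- A function on scales whose variation at scale `R` is at most `K R^{1-α}` varies, between the
scales `r ≤ ρ`, by at most `2 K ρ / r^α`. -/
lemma rpow_mul_sub_le_of_forall_dyadic {α K : ℝ} (hα : 0 ≤ α) (hK : 0 ≤ K) {b : ℝ → ℝ}
    (hb : ∀ ρ R, 0 < ρ → ρ ≤ R → R ≤ 2 * ρ → |b ρ - b R| ≤ K * R ^ (1 - α))
    {r ρ : ℝ} (hr : 0 < r) (hrρ : r ≤ ρ) : r ^ α * (b r - b ρ) ≤ 2 * K * ρ := by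
  have hstep : ∀ σ R, 0 < σ → r ≤ R → σ ≤ R → R ≤ 2 * σ → r ^ α * (b σ - b R) ≤ K * R := by
    intro σ R hσ hrR hσR hR
    have hRpos : 0 < R := hr.trans_le hrR
    calc r ^ α * (b σ - b R) ≤ R ^ α * (K * R ^ (1 - α)) := by
          refine (mul_le_mul_of_nonneg_left
            ((le_abs_self _).trans (hb σ R hσ hσR hR)) (by positivity)).trans ?_
          gcongr
      _ = K * (R ^ α * R ^ (1 - α)) := by ring
      _ = K * R := by rw [← Real.rpow_add hRpos]; simp
  have key : ∀ n : ℕ, ∀ ρ, r ≤ ρ → ρ ≤ 2 ^ n * r → r ^ α * (b r - b ρ) ≤ 2 * K * ρ := by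
    intro n
    induction n with
    | zero =>
      intro ρ h1 h2
      have : ρ = r := le_antisymm (by simpa using h2) h1
      subst this
      simp only [sub_self, mul_zero]
      positivity
    | succ n ih =>
      intro ρ h1 h2
      have hρ : 0 < ρ := hr.trans_le h1
      rcases le_total ρ (2 * r) with h | h
      · have := hstep r ρ hr h1 h1 h
        nlinarith [mul_nonneg hK hρ.le]
      · have e1 := ih (ρ / 2) (by linarith) (by rw [pow_succ] at h2; linarith)
        have e2 := hstep (ρ / 2) ρ (by linarith) h1 (by linarith) (by linarith)
        linarith
  obtain ⟨n, hn⟩ := pow_unbounded_of_one_lt (ρ / r) (one_lt_two : (1 : ℝ) < 2)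
  exact key n ρ hrρ ((div_le_iff₀ hr).1 hn.le)

lemma rpow_mul_ten_mul_rpow_le {α : ℝ} (hα : 0 ≤ α) {r : ℝ} (hr : 0 < r) :
    r ^ α * (10 * r) ^ (1 - α) ≤ 10 * r := by
  calc r ^ α * (10 * r) ^ (1 - α) ≤ (10 * r) ^ α * (10 * r) ^ (1 - α) := by
        gcongr
        linarith
    _ = 10 * r := by rw [← Real.rpow_add (by positivity)]; simp

/-- If the means of `|u|` over comparable balls of radius about `R` near `x` differ by at most
`K R^{1-α}`, then `M*_α u(x)` exceeds `M*_α u(y)` by at most a constant times `K d(x,y)`. -/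
lemma DiscreteMaxData.dMax_le_dMax_add [MetricSpace X] [MeasurableSpace X] (μ : Measure X)
    (D : DiscreteMaxData X) {α K : ℝ} (hα : 0 ≤ α) (hK : 0 ≤ K) {u : X → ℝ} {x : X}
    (hfin : ∀ z ρ, 0 < ρ → dist z x ≤ 9 * ρ → ⨍⁻ y in ball z ρ, ‖u y‖₊ ∂μ ≠ ⊤)
    (hosc : ∀ z ρ z' ρ' R, 0 < ρ → dist z x + ρ ≤ R → R ≤ 10 * ρ →
      0 < ρ' → dist z' x + ρ' ≤ R → R ≤ 10 * ρ' →
      |(⨍⁻ y in ball z ρ, ‖u y‖₊ ∂μ).toReal - (⨍⁻ y in ball z' ρ', ‖u y‖₊ ∂μ).toReal| ≤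
        K * R ^ (1 - α)) (y : X) :
    D.dMax μ α u x ≤ D.dMax μ α u y + ENNReal.ofReal ((20 * D.N * D.L + 70) * (K * dist x y)) := by
  classical
  rcases eq_or_ne x y with rfl | hxy
  · simp
  have hd : 0 < dist x y := dist_pos.2 hxy
  have hL := D.L_pos
  set a : X → ℝ → ℝ := fun z ρ => (⨍⁻ y in ball z ρ, (‖u y‖₊ : ℝ≥0∞) ∂μ).toReal with ha
  have ha0 : ∀ z ρ, 0 ≤ a z ρ := fun z ρ => ENNReal.toReal_nonneg
  -- the discrete convolution at a point `w`, as a finite real sum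
  have hconv : ∀ (r : ℚ), 0 < r → ∀ w, ∀ I : Finset ℕ,
      (∀ i ∉ I, D.φ r i w = 0) → (∀ i ∈ I, dist (D.center r i) x < 7 * (r : ℝ)) →
      ENNReal.ofReal ((r : ℝ) ^ α) * ∑' i : ℕ, ENNReal.ofReal (D.φ r i w) *
        ⨍⁻ y in ball (D.center r i) (3 * (r : ℝ)), ‖u y‖₊ ∂μ =
      ENNReal.ofReal ((r : ℝ) ^ α * ∑ i ∈ I, D.φ r i w * a (D.center r i) (3 * r)) := by
    intro r hr w I hI hIx
    have hr' : (0 : ℝ) < r := by exact_mod_cast hr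
    rw [D.tsum_φ_mul_eq_ofReal r hI fun i hi => hfin _ _ (by positivity)
      (by linarith [hIx i hi]), ENNReal.ofReal_mul (by positivity)]
  have hclose : ∀ (r : ℚ), 0 < r → ∀ z, dist z x < 7 * (r : ℝ) →
      |a z (3 * r) - a x (10 * r)| ≤ K * (10 * r) ^ (1 - α) := by
    intro r hr z hz
    have hr' : (0 : ℝ) < r := by exact_mod_cast hr
    exact hosc _ _ _ _ _ (by positivity) (by linarith) (by linarith) (by positivity)
      (by simp) (by linarith)
  have hle : ∀ (r : ℚ), 0 < r → ENNReal.ofReal ((r : ℝ) ^ α) *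
      ∑' i : ℕ, ENNReal.ofReal (D.φ r i y) *
        ⨍⁻ y in ball (D.center r i) (3 * (r : ℝ)), ‖u y‖₊ ∂μ ≤ D.dMax μ α u y :=
    fun r hr => le_iSup₂_of_le (f := fun (r : ℚ) (_ : 0 < r) => ENNReal.ofReal ((r : ℝ) ^ α) *
      ∑' i : ℕ, ENNReal.ofReal (D.φ r i y) *
        ⨍⁻ y in ball (D.center r i) (3 * (r : ℝ)), ‖u y‖₊ ∂μ) r hr le_rfl
  refine iSup₂_le fun r hr => ?_
  have hr' : (0 : ℝ) < r := by exact_mod_cast hr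
  obtain ⟨Ix, hIxN, hIx0, hIx⟩ := D.exists_finset_support hr x
  rcases le_or_gt (dist x y) r with hdr | hrd
  · obtain ⟨Iy, hIyN, hIy0, hIy⟩ := D.exists_finset_support hr y
    have hx0 : ∀ i ∉ Ix ∪ Iy, D.φ r i x = 0 := fun i hi =>
      hIx0 i fun h => hi (Finset.mem_union_left _ h)
    have hy0 : ∀ i ∉ Ix ∪ Iy, D.φ r i y = 0 := fun i hi =>
      hIy0 i fun h => hi (Finset.mem_union_right _ h)
    have hnear : ∀ i ∈ Ix ∪ Iy, dist (D.center r i) x < 7 * (r : ℝ) := by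
      intro i hi
      rcases Finset.mem_union.1 hi with h | h
      · linarith [hIx i h]
      · linarith [hIy i h, dist_triangle (D.center r i) y x, dist_comm x y]
    have hcard : ((Ix ∪ Iy).card : ℝ) ≤ 2 * D.N := by
      have := Finset.card_union_le Ix Iy
      exact_mod_cast (by omega : (Ix ∪ Iy).card ≤ 2 * D.N)
    have hdiff := D.abs_sum_φ_sub_sum_φ_le hr hx0 hy0 fun i hi => hclose r hr _ (hnear i hi)
    refine le_trans ?_ (add_le_add_left (hle r hr) _)
    rw [hconv r hr x _ hx0 hnear,
      hconv r hr y _ hy0 hnear, ← ENNReal.ofReal_add]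
    · refine ENNReal.ofReal_le_ofReal ?_
      have h1 := le_of_abs_le hdiff
      set Sx := ∑ i ∈ Ix ∪ Iy, D.φ r i x * a (D.center r i) (3 * r)
      set Sy := ∑ i ∈ Ix ∪ Iy, D.φ r i y * a (D.center r i) (3 * r)
      have h2 : (r : ℝ) ^ α * (Sx - Sy) ≤ 20 * D.N * D.L * (K * dist x y) := by
        calc (r : ℝ) ^ α * (Sx - Sy)
            ≤ r ^ α * (2 * D.N * (D.L / r * dist x y * (K * (10 * r) ^ (1 - α)))) := by
              refine mul_le_mul_of_nonneg_left (h1.trans ?_) (by positivity)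
              gcongr
          _ = (2 * D.N * D.L * (K * dist x y)) / r * (r ^ α * (10 * r) ^ (1 - α)) := by ring
          _ ≤ (2 * D.N * D.L * (K * dist x y)) / r * (10 * r) :=
            mul_le_mul_of_nonneg_left (rpow_mul_ten_mul_rpow_le hα hr') (by positivity)
          _ = 20 * D.N * D.L * (K * dist x y) := by field_simp; ring
      have h3 : 0 ≤ K * dist x y := by positivity
      linarith
    · exact mul_nonneg (by positivity)
        (Finset.sum_nonneg fun i _ => mul_nonneg (D.φ_nonneg _ _ _) (ha0 _ _))
    · positivity
  · obtain ⟨d, hd1, hd2⟩ := exists_rat_btwn (show dist x y < 2 * dist x y by linarith)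
    have hdpos : 0 < d := by exact_mod_cast hd.trans hd1
    have hd' : (0 : ℝ) < d := by exact_mod_cast hdpos
    obtain ⟨Iy, -, hIy0, hIy⟩ := D.exists_finset_support hdpos y
    have hnearx : ∀ i ∈ Ix, dist (D.center r i) x < 7 * (r : ℝ) := fun i hi => by
      linarith [hIx i hi]
    have hneary : ∀ i ∈ Iy, dist (D.center d i) x < 7 * (d : ℝ) := fun i hi => by
      linarith [hIy i hi, dist_triangle (D.center d i) y x, dist_comm x y]
    have hx := D.abs_sum_φ_sub_le hr hIx0 fun i hi => hclose r hr _ (hnearx i hi)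
    have hy := D.abs_sum_φ_sub_le hdpos hIy0 fun i hi => hclose d hdpos _ (hneary i hi)
    refine le_trans ?_ (add_le_add_left (hle d hdpos) _)
    rw [hconv r hr x _ hIx0 hnearx,
      hconv d hdpos y _ hIy0 hneary, ← ENNReal.ofReal_add]
    · refine ENNReal.ofReal_le_ofReal ?_
      set Sx := ∑ i ∈ Ix, D.φ r i x * a (D.center r i) (3 * r)
      set Sy := ∑ i ∈ Iy, D.φ d i y * a (D.center d i) (3 * d)
      have hrd' : (r : ℝ) ≤ d := (hrd.trans hd1).le
      have h1 : (r : ℝ) ^ α * (Sx - a x (10 * r)) ≤ K * (10 * r) := by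
        calc (r : ℝ) ^ α * (Sx - a x (10 * r)) ≤ r ^ α * (K * (10 * r) ^ (1 - α)) := by
              gcongr
              exact le_of_abs_le hx
          _ = K * (r ^ α * (10 * r) ^ (1 - α)) := by ring
          _ ≤ K * (10 * r) :=
            mul_le_mul_of_nonneg_left (rpow_mul_ten_mul_rpow_le hα hr') (by positivity)
      have h2 : (r : ℝ) ^ α * (a x (10 * r) - a x (10 * d)) ≤ 2 * K * (10 * d) := by
        have hb := rpow_mul_sub_le_of_forall_dyadic (b := a x) hα hK (fun ρ R hρ hρR hR =>
          hosc x ρ x R R hρ (by simpa using hρR) (by linarith) (by linarith) (by simp)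
            (by linarith)) (show (0 : ℝ) < 10 * r by positivity)
            (show (10 * r : ℝ) ≤ 10 * d by linarith)
        rcases le_total 0 (a x (10 * r) - a x (10 * d)) with h | h
        · refine le_trans ?_ hb
          gcongr
          linarith
        · exact (mul_nonpos_of_nonneg_of_nonpos (by positivity) h).trans (by positivity)
      have h3 : (r : ℝ) ^ α * a x (10 * d) ≤ d ^ α * a x (10 * d) := by
        have := ha0 x (10 * d)
        gcongr
      have h4 : (d : ℝ) ^ α * (a x (10 * d) - Sy) ≤ K * (10 * d) := by
        calc (d : ℝ) ^ α * (a x (10 * d) - Sy) ≤ d ^ α * (K * (10 * d) ^ (1 - α)) := by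
              gcongr
              rw [abs_sub_comm] at hy
              exact le_of_abs_le hy
          _ = K * (d ^ α * (10 * d) ^ (1 - α)) := by ring
          _ ≤ K * (10 * d) :=
            mul_le_mul_of_nonneg_left (rpow_mul_ten_mul_rpow_le hα hd') (by positivity)
      have h5 : K * r ≤ K * dist x y := by gcongr
      have h6 : K * d ≤ K * (2 * dist x y) := by gcongr
      have h7 : 0 ≤ 20 * D.N * D.L * (K * dist x y) := by positivity
      linarith
    · exact mul_nonneg (by positivity)
        (Finset.sum_nonneg fun i _ => mul_nonneg (D.φ_nonneg _ _ _) (ha0 _ _))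
    · positivity

section Poincare

/-- Chaining through points at which the gradient is smaller and smaller: if near every point
there are points where `g ≤ 2 ^ j * l`, at distance decaying geometrically in `j`, then `u` is
pointwise controlled by `g ^ t`. -/
lemma exists_abs_sub_le_of_chain [MetricSpace X] {u g : X → ℝ} {E : Set X} {s t θ l r : ℝ} {x₀ : X}
    (hs : 0 ≤ s) (ht : 0 < t) (hθ0 : 0 < θ) (hθ1 : θ < 1) (hθ : 2 * θ ^ s = 2 ^ t)
    (hl : 0 < l) (hr : 0 < r) (hg : ∀ x, 0 ≤ g x)
    (hE : ∀ x ∉ E, ∀ y ∉ E, |u x - u y| ≤ dist x y ^ s * (g x + g y))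
    (hnear : ∀ (j : ℕ), ∀ x ∈ ball x₀ (r * (1 + θ ^ (j + 1))),
      ∃ y ∈ ball x (r * ((1 - θ) * θ ^ j)), y ∉ E ∧ g y ≤ 2 ^ j * l) :
    ∃ c : ℝ, ∀ x ∈ ball x₀ r, x ∉ E →
      |u x - c| ≤ (3 / (2 ^ t - 1) + 2 * 4 ^ s) * l * r ^ s * (1 + 2 ^ t * (g x / l) ^ t) := by
  obtain ⟨z, hz, hzE, hgz⟩ := hnear 0 x₀ (mem_ball_self (by positivity))
  simp only [pow_zero, mul_one, one_mul] at hz hgz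
  have hτ : (1 : ℝ) < 2 ^ t := Real.one_lt_rpow one_lt_two ht
  set τ : ℝ := 2 ^ t
  set D : ℝ := 3 / (τ - 1) + 2 * 4 ^ s with hD
  have hD3 : 3 ≤ D * (τ - 1) := by
    rw [hD, add_mul, div_mul_cancel₀ _ (by linarith)]
    have : 0 ≤ 2 * (4 : ℝ) ^ s * (τ - 1) := mul_nonneg (by positivity) (by linarith)
    linarith
  have hD4 : 2 * 4 ^ s ≤ D := by
    have : 0 ≤ 3 / (τ - 1) := div_nonneg (by norm_num) (by linarith)
    linarith
  have hD0 : 0 ≤ D := le_trans (by positivity) hD4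
  have key : ∀ (j : ℕ), ∀ x ∈ ball x₀ (r * (1 + θ ^ j)), x ∉ E → g x ≤ 2 ^ j * l →
      |u x - u z| ≤ D * l * r ^ s * τ ^ j := by
    intro j
    induction j with
    | zero =>
      intro x hx hxE hgx
      simp only [pow_zero, mul_one, one_mul] at hx hgx ⊢
      have hdist : dist x z ≤ 4 * r := by
        rw [mem_ball] at hx hz
        have := dist_triangle_right x z x₀
        nlinarith [mul_pos hr hθ0]
      calc |u x - u z| ≤ dist x z ^ s * (g x + g z) := hE x hxE z hzE
        _ ≤ dist x z ^ s * (l + l) := by gcongr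
        _ ≤ (4 * r) ^ s * (l + l) := by gcongr
        _ = 2 * 4 ^ s * l * r ^ s := by rw [Real.mul_rpow (by norm_num) hr.le]; ring
        _ ≤ D * l * r ^ s := by gcongr
    | succ j ih =>
      intro x hx hxE hgx
      obtain ⟨y, hyx, hyE, hgy⟩ := hnear j x hx
      have hθj : 0 < θ ^ j := by positivity
      have hy : y ∈ ball x₀ (r * (1 + θ ^ j)) := by
        rw [mem_ball] at hx hyx ⊢
        have := dist_triangle y x x₀
        rw [pow_succ] at hx
        nlinarith
      have hxy : dist x y ≤ r * θ ^ j := by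
        rw [mem_ball, dist_comm] at hyx
        nlinarith [mul_pos hr hθj]
      have hstep : |u x - u y| ≤ 3 * (l * r ^ s * τ ^ j) := by
        calc |u x - u y| ≤ dist x y ^ s * (g x + g y) := hE x hxE y hyE
          _ ≤ dist x y ^ s * (2 ^ (j + 1) * l + 2 ^ j * l) := by gcongr
          _ ≤ (r * θ ^ j) ^ s * (2 ^ (j + 1) * l + 2 ^ j * l) := by gcongr
          _ = 3 * (l * r ^ s * (2 * θ ^ s) ^ j) := by
              rw [Real.mul_rpow hr.le hθj.le, ← Real.rpow_natCast θ, ← Real.rpow_mul hθ0.le,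
                mul_comm (j : ℝ) s, Real.rpow_mul hθ0.le, Real.rpow_natCast, mul_pow, pow_succ]
              ring
          _ = _ := by rw [hθ]
      have hprev := ih y hy hyE hgy
      have htri := abs_sub_le (u x) (u y) (u z)
      have hpos : 0 ≤ l * r ^ s * τ ^ j := by positivity
      calc |u x - u z| ≤ 3 * (l * r ^ s * τ ^ j) + D * l * r ^ s * τ ^ j := by linarith
        _ ≤ D * (τ - 1) * (l * r ^ s * τ ^ j) + D * l * r ^ s * τ ^ j := by gcongr
        _ = D * l * r ^ s * τ ^ (j + 1) := by ring
  refine ⟨u z, fun x hx hxE => ?_⟩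
  have hex : ∃ j : ℕ, g x ≤ 2 ^ j * l := by
    obtain ⟨j, hj⟩ := pow_unbounded_of_one_lt (g x / l) (one_lt_two : (1 : ℝ) < 2)
    exact ⟨j, ((div_lt_iff₀ hl).1 hj).le⟩
  classical
  have hin : ∀ j : ℕ, x ∈ ball x₀ (r * (1 + θ ^ j)) := fun j =>
    ball_subset_ball (by have : 0 < r * θ ^ j := by positivity
                         linarith) hx
  have hfind := key _ x (hin _) hxE (Nat.find_spec hex)
  refine hfind.trans ?_
  rcases hj : Nat.find hex with _ | k
  · have : 0 ≤ τ * (g x / l) ^ t := by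
      have := hg x
      positivity
    gcongr
    simpa using this
  · have hk : 2 ^ k * l < g x := not_le.1 (Nat.find_min hex (by omega))
    have hτk : τ ^ k ≤ (g x / l) ^ t := by
      rw [← Real.rpow_natCast, ← Real.rpow_mul (by norm_num), mul_comm, Real.rpow_mul (by norm_num),
        Real.rpow_natCast]
      refine Real.rpow_le_rpow (by positivity) ?_ ht.le
      rw [le_div_iff₀ hl]
      exact hk.le
    gcongr
    rw [pow_succ]
    nlinarith

/-- A Poincaré inequality for Hajłasz functions, with the exponent `Q / (Q + s)` on the right. -/
lemma exists_const_lintegral_sub_le [MetricSpace X] [MeasurableSpace X] [BorelSpace X]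
    {μ : Measure X} {Q c_Q : ℝ} (hdim : DimLowerBound μ c_Q Q) (hcQ : 0 < c_Q) (hQ : 0 < Q)
    (hpos : ∀ (x : X) (r : ℝ), 0 < r → μ (ball x r) ≠ 0)
    (hfin : ∀ (x : X) (r : ℝ), μ (ball x r) ≠ ⊤) {s : ℝ} (hs : 0 ≤ s) :
    ∃ C : ℝ, 0 < C ∧ ∀ u g : X → ℝ, IsHajlaszGradient μ s u g → ∀ (x₀ : X) (r A : ℝ), 0 < r →
      0 < A → ∫⁻ y in ball x₀ (2 * r), ENNReal.ofReal (g y ^ (Q / (Q + s))) ∂μ ≤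
        ENNReal.ofReal A * μ (ball x₀ (2 * r)) →
      ∃ c : ℝ, ∫⁻ y in ball x₀ r, ‖u y - c‖ₑ ∂μ ≤
        ENNReal.ofReal (C * (r ^ s * A ^ (Q / (Q + s))⁻¹)) * μ (ball x₀ r) := by
  have hQs : 0 < Q + s := by positivity
  set t : ℝ := Q / (Q + s) with ht_def
  have ht : 0 < t := by positivity
  set θ : ℝ := 2 ^ (-(t / Q)) with hθ_def
  have hθ0 : 0 < θ := by positivity
  have hθ1 : θ < 1 := Real.rpow_lt_one_of_one_lt_of_neg one_lt_two (by
    have : 0 < t / Q := by positivity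
    linarith)
  have hθs : 2 * θ ^ s = 2 ^ t := by
    have hexp : t = 1 + -(t / Q) * s := by
      rw [ht_def]; field_simp; ring
    conv_rhs => rw [hexp, Real.rpow_add two_pos, Real.rpow_one]
    rw [hθ_def, ← Real.rpow_mul two_pos.le]
  have hθQ : θ ^ Q = (2 ^ t)⁻¹ := by
    rw [hθ_def, ← Real.rpow_mul two_pos.le, ← Real.rpow_neg two_pos.le]
    congr 1
    field_simp
  have hτ : (1 : ℝ) < 2 ^ t := Real.one_lt_rpow one_lt_two ht
  set κ : ℝ := c_Q * ((1 - θ) / 2) ^ Q with hκ_def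
  have hθ2 : 0 < (1 - θ) / 2 := by linarith
  have hκ : 0 < κ := by positivity
  set D : ℝ := 3 / (2 ^ t - 1) + 2 * 4 ^ s with hD
  have hD0 : 0 < D := by
    have : 0 < 3 / ((2 : ℝ) ^ t - 1) := div_pos (by norm_num) (by linarith)
    positivity
  refine ⟨D * (2 / κ) ^ t⁻¹ * (1 + 2 ^ t * (κ / 2) * (c_Q⁻¹ * 2 ^ Q)), by positivity, ?_⟩
  rintro u g ⟨hgm, hg, E, hE0, hE⟩ x₀ r A hr hA hgint
  set l : ℝ := (2 / κ * A) ^ t⁻¹ with hl_def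
  have hl : 0 < l := by positivity
  have hlt : l ^ t = 2 / κ * A := by
    rw [hl_def, ← Real.rpow_mul (by positivity), inv_mul_cancel₀ ht.ne', Real.rpow_one]
  set m := μ (ball x₀ (2 * r)) with hm
  have hm0 : m ≠ 0 := hpos _ _ (by positivity)
  have hmt : m ≠ ⊤ := hfin _ _
  have hnear : ∀ (j : ℕ), ∀ x ∈ ball x₀ (r * (1 + θ ^ (j + 1))),
      ∃ y ∈ ball x (r * ((1 - θ) * θ ^ j)), y ∉ E ∧ g y ≤ 2 ^ j * l := by
    intro j x hx
    have hθj : 0 < θ ^ j := by positivity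
    have hθj1 : θ ^ j ≤ 1 := pow_le_one₀ hθ0.le hθ1.le
    set ρ : ℝ := r * ((1 - θ) * θ ^ j) with hρ
    have hρ0 : 0 < ρ := mul_pos hr (mul_pos (by linarith) hθj)
    have hρr : ρ ≤ r := mul_le_of_le_one_right hr.le (by nlinarith)
    have hsub : ball x ρ ⊆ ball x₀ (2 * r) := by
      refine ball_subset_ball' ?_
      rw [mem_ball, pow_succ] at hx
      rw [hρ]
      nlinarith
    by_contra! hcon
    have hbad : ball x ρ ⊆
        {y | ENNReal.ofReal ((2 ^ j * l) ^ t) ≤ ENNReal.ofReal (g y ^ t)} ∩ ball x₀ (2 * r) ∪ E := by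
      intro y hy
      by_cases hyE : y ∈ E
      · exact Or.inr hyE
      · refine Or.inl ⟨ENNReal.ofReal_le_ofReal ?_, hsub hy⟩
        exact Real.rpow_le_rpow (by positivity) (hcon y hy hyE).le ht.le
    have hmarkov := mul_meas_ge_le_lintegral (μ := μ.restrict (ball x₀ (2 * r)))
      (f := fun y => ENNReal.ofReal (g y ^ t)) (by fun_prop) (ENNReal.ofReal ((2 ^ j * l) ^ t))
    rw [Measure.restrict_apply' measurableSet_ball] at hmarkov
    have hball : μ (ball x ρ) ≤
        μ ({y | ENNReal.ofReal ((2 ^ j * l) ^ t) ≤ ENNReal.ofReal (g y ^ t)} ∩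
          ball x₀ (2 * r)) := by
      refine (measure_mono hbad).trans ((measure_union_le _ _).trans ?_)
      rw [hE0, add_zero]
    have hlow := hdim x₀ x ρ (2 * r) hρ0 (by linarith) (hsub (mem_ball_self hρ0))
    have hratio : c_Q * (ρ / (2 * r)) ^ Q = κ * ((2 ^ t) ^ j)⁻¹ := by
      have : ρ / (2 * r) = (1 - θ) / 2 * θ ^ j := by rw [hρ]; field_simp
      rw [this, Real.mul_rpow hθ2.le hθj.le, ← Real.rpow_natCast θ, ← Real.rpow_mul hθ0.le,
        mul_comm (j : ℝ), Real.rpow_mul hθ0.le, hθQ, Real.rpow_natCast, inv_pow, hκ_def, mul_assoc]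
    have hjl : (2 ^ j * l) ^ t = (2 ^ t) ^ j * (2 / κ * A) := by
      rw [Real.mul_rpow (by positivity) hl.le, hlt, ← Real.rpow_natCast, ← Real.rpow_natCast,
        ← Real.rpow_mul two_pos.le, ← Real.rpow_mul two_pos.le, mul_comm (j : ℝ)]
    have hcontra : ENNReal.ofReal (2 * A) * m ≤ ENNReal.ofReal A * m := by
      calc ENNReal.ofReal (2 * A) * m
          = ENNReal.ofReal ((2 ^ j * l) ^ t) *
              (ENNReal.ofReal (c_Q * (ρ / (2 * r)) ^ Q) * m) := by
            rw [← mul_assoc, ← ENNReal.ofReal_mul (by positivity), hjl, hratio]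
            congr 2
            field_simp
        _ ≤ ENNReal.ofReal ((2 ^ j * l) ^ t) * μ (ball x ρ) := by gcongr
        _ ≤ _ := (mul_le_mul_right hball _).trans (hmarkov.trans hgint)
    rw [ENNReal.mul_le_mul_iff_left hm0 hmt, ENNReal.ofReal_le_ofReal_iff hA.le] at hcontra
    linarith
  obtain ⟨c, hc⟩ := exists_abs_sub_le_of_chain hs ht hθ0 hθ1 hθs hl hr hg hE hnear
  refine ⟨c, ?_⟩
  set F : ℝ := D * l * r ^ s with hF
  have hF0 : 0 ≤ F := by positivity
  calc ∫⁻ y in ball x₀ r, ‖u y - c‖ₑ ∂μ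
      ≤ ∫⁻ y in ball x₀ r, (ENNReal.ofReal F +
          ENNReal.ofReal (F * 2 ^ t * (l ^ t)⁻¹) * ENNReal.ofReal (g y ^ t)) ∂μ := by
        refine lintegral_mono_ae ?_
        rw [ae_restrict_iff' measurableSet_ball]
        have hEae : ∀ᵐ y ∂μ, y ∉ E := measure_eq_zero_iff_ae_notMem.1 hE0
        filter_upwards [hEae] with y hyE hy
        have hgy := hg y
        rw [Real.enorm_eq_ofReal_abs, ← ENNReal.ofReal_mul (by positivity),
          ← ENNReal.ofReal_add hF0 (by positivity)]
        refine ENNReal.ofReal_le_ofReal ((hc y hy hyE).trans (le_of_eq ?_))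
        rw [Real.div_rpow hgy hl.le]
        ring
    _ = ENNReal.ofReal F * μ (ball x₀ r) + ENNReal.ofReal (F * 2 ^ t * (l ^ t)⁻¹) *
          ∫⁻ y in ball x₀ r, ENNReal.ofReal (g y ^ t) ∂μ := by
        rw [lintegral_add_left measurable_const, lintegral_const, Measure.restrict_apply_univ,
          lintegral_const_mul _ (by fun_prop)]
    _ ≤ ENNReal.ofReal F * μ (ball x₀ r) + ENNReal.ofReal (F * 2 ^ t * (l ^ t)⁻¹) *
          (ENNReal.ofReal A * (ENNReal.ofReal (c_Q⁻¹ * 2 ^ Q) * μ (ball x₀ r))) := by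
        gcongr
        refine (lintegral_mono_set (ball_subset_ball (by linarith))).trans (hgint.trans ?_)
        gcongr
        exact hdim.measure_ball_le hcQ hQ.le hr (by linarith) le_rfl
          (mem_ball_self (by positivity))
    _ = _ := by
        rw [← mul_assoc (ENNReal.ofReal A), ← mul_assoc, ← add_mul,
          ← ENNReal.ofReal_mul (by positivity), ← ENNReal.ofReal_mul (by positivity),
          ← ENNReal.ofReal_add hF0 (by positivity)]
        congr 2
        rw [hlt, hF, hl_def, Real.mul_rpow (by positivity) hA.le]
        field_simp

end Poincare

section MaximalFunction

variable [MetricSpace X] [MeasurableSpace X]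

/-- The uncentered Hardy–Littlewood maximal function. -/
noncomputable def hlMax (μ : Measure X) (f : X → ℝ≥0∞) (x : X) : ℝ≥0∞ :=
  ⨆ (z : X) (ρ : ℝ) (_ : x ∈ ball z ρ), ⨍⁻ y in ball z ρ, f y ∂μ

variable {μ : Measure X}

lemma lt_hlMax_iff {f : X → ℝ≥0∞} {x : X} {l : ℝ≥0∞} :
    l < hlMax μ f x ↔ ∃ z ρ, x ∈ ball z ρ ∧ l < ⨍⁻ y in ball z ρ, f y ∂μ := by
  simp only [hlMax, lt_iSup_iff, exists_prop]

lemma laverage_le_hlMax (f : X → ℝ≥0∞) {x z : X} {ρ : ℝ} (hx : x ∈ ball z ρ) :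
    ⨍⁻ y in ball z ρ, f y ∂μ ≤ hlMax μ f x :=
  le_iSup_of_le z (le_iSup₂_of_le (f := fun (ρ : ℝ) (_ : x ∈ ball z ρ) =>
    ⨍⁻ y in ball z ρ, f y ∂μ) ρ hx le_rfl)

lemma measurable_hlMax [BorelSpace X] (f : X → ℝ≥0∞) : Measurable (hlMax μ f) := by
  refine LowerSemicontinuous.measurable (lowerSemicontinuous_iff_isOpen_preimage.2 fun l => ?_)
  have : hlMax μ f ⁻¹' Set.Ioi l =
      ⋃ (z : X) (ρ : ℝ) (_ : l < ⨍⁻ y in ball z ρ, f y ∂μ), ball z ρ := by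
    ext x
    simp only [Set.mem_preimage, Set.mem_Ioi, lt_hlMax_iff, Set.mem_iUnion, exists_prop]
    tauto
  rw [this]
  exact isOpen_iUnion fun z => isOpen_iUnion fun ρ => isOpen_iUnion fun _ => isOpen_ball

/-- The weak type `(1,1)` estimate for the maximal function. -/
lemma mul_measure_lt_hlMax_le [BorelSpace X] [TopologicalSpace.SeparableSpace X] {c_Q Q : ℝ}
    (hdim : DimLowerBound μ c_Q Q) (hcQ : 0 < c_Q) (hQ : 0 ≤ Q)
    (hpos : ∀ (x : X) (r : ℝ), 0 < r → μ (ball x r) ≠ 0)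
    (hfin : ∀ (x : X) (r : ℝ), μ (ball x r) ≠ ⊤) (f : X → ℝ≥0∞) (l : ℝ≥0∞) :
    l * μ {x | l < hlMax μ f x} ≤ ENNReal.ofReal (c_Q⁻¹ * 5 ^ Q) * ∫⁻ x, f x ∂μ := by
  set S : ℕ → Set X := fun n => {x | ∃ (z : X) (ρ : ℝ), ρ ≤ n ∧ x ∈ ball z ρ ∧
    l < ⨍⁻ y in ball z ρ, f y ∂μ} with hS
  have hSunion : {x | l < hlMax μ f x} = ⋃ n, S n := by
    ext x
    simp only [Set.mem_ofPred_eq, lt_hlMax_iff, Set.mem_iUnion, hS]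
    constructor
    · rintro ⟨z, ρ, hx, hl⟩
      obtain ⟨n, hn⟩ := exists_nat_ge ρ
      exact ⟨n, z, ρ, hn, hx, hl⟩
    · rintro ⟨n, z, ρ, -, hx, hl⟩
      exact ⟨z, ρ, hx, hl⟩
  have hSmono : Monotone S := fun m n hmn x ⟨z, ρ, hρ, h⟩ =>
    ⟨z, ρ, hρ.trans (by exact_mod_cast hmn), h⟩
  rw [hSunion, hSmono.measure_iUnion, ENNReal.mul_iSup]
  refine iSup_le fun n => ?_
  set T : Set (X × ℝ) := {a | 0 < a.2 ∧ a.2 ≤ n ∧ l < ⨍⁻ y in ball a.1 a.2, f y ∂μ} with hT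
  obtain ⟨v, hvT, hdisj, hcov⟩ := Vitali.exists_disjoint_subfamily_covering_enlargement_closedBall
    T Prod.fst Prod.snd n (fun a ha => ha.2.1) 4 (by norm_num)
  have hdisj' : v.PairwiseDisjoint fun a => ball a.1 a.2 :=
    hdisj.mono fun a => ball_subset_closedBall
  have hvc : v.Countable := hdisj'.countable_of_isOpen (fun _ _ => isOpen_ball)
    fun a ha => ⟨a.1, mem_ball_self (hvT ha).1⟩
  have hsub : S n ⊆ ⋃ a ∈ v, ball a.1 (5 * a.2) := by
    rintro x ⟨z, ρ, hρn, hx, hl⟩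
    have hρ : 0 < ρ := pos_of_mem_ball hx
    obtain ⟨b, hb, hzb⟩ := hcov (z, ρ) ⟨hρ, hρn, hl⟩
    refine Set.mem_biUnion hb ?_
    refine closedBall_subset_ball ?_ (hzb (ball_subset_closedBall hx))
    linarith [(hvT hb).1]
  have hball : ∀ a ∈ v, l * μ (ball a.1 a.2) ≤ ∫⁻ y in ball a.1 a.2, f y ∂μ := by
    intro a ha
    obtain ⟨ha0, -, hl⟩ := hvT ha
    rw [setLAverage_eq] at hl
    exact (ENNReal.le_div_iff_mul_le (Or.inl (hpos _ _ ha0)) (Or.inl (hfin _ _))).1 hl.le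
  have := hvc.to_subtype
  calc l * μ (S n) ≤ l * ∑' a : v, μ (ball a.1.1 (5 * a.1.2)) := by
        gcongr
        exact (measure_mono hsub).trans (measure_biUnion_le μ hvc _)
    _ ≤ l * ∑' a : v, ENNReal.ofReal (c_Q⁻¹ * 5 ^ Q) * μ (ball a.1.1 a.1.2) := by
        gcongr with a
        have ha0 := (hvT a.2).1
        exact hdim.measure_ball_le hcQ hQ ha0 (by linarith) le_rfl
          (mem_ball_self (by positivity))
    _ = ENNReal.ofReal (c_Q⁻¹ * 5 ^ Q) * ∑' a : v, l * μ (ball a.1.1 a.1.2) := by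
        rw [ENNReal.tsum_mul_left, ENNReal.tsum_mul_left]; ring
    _ ≤ ENNReal.ofReal (c_Q⁻¹ * 5 ^ Q) * ∑' a : v, ∫⁻ y in ball a.1.1 a.1.2, f y ∂μ := by
        gcongr with a
        exact hball a a.2
    _ = ENNReal.ofReal (c_Q⁻¹ * 5 ^ Q) * ∫⁻ y in ⋃ a ∈ v, ball a.1 a.2, f y ∂μ := by
        rw [lintegral_biUnion hvc (fun _ _ => measurableSet_ball) hdisj']
    _ ≤ _ := by
        gcongr
        exact Measure.restrict_le_self

lemma hlMax_le_hlMax_indicator_add (f : X → ℝ≥0∞) (l : ℝ≥0∞) (x : X) :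
    hlMax μ f x ≤ hlMax μ ({y | l < f y}.indicator f) x + l := by
  refine iSup_le fun z => iSup₂_le fun ρ hx => ?_
  refine le_trans ?_ (add_le_add_left (laverage_le_hlMax _ hx) l)
  rw [setLAverage_eq, setLAverage_eq]
  calc (∫⁻ y in ball z ρ, f y ∂μ) / μ (ball z ρ)
      ≤ (∫⁻ y in ball z ρ, ({y | l < f y}.indicator f y + l) ∂μ) / μ (ball z ρ) := by
        gcongr with y
        by_cases h : l < f y
        · simp [h]
        · simpa [h] using not_lt.1 h
    _ = (∫⁻ y in ball z ρ, {y | l < f y}.indicator f y ∂μ) / μ (ball z ρ) +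
          l * (μ (ball z ρ) / μ (ball z ρ)) := by
        rw [lintegral_add_right _ measurable_const, lintegral_const, Measure.restrict_apply_univ,
          ENNReal.add_div, mul_div_assoc]
    _ ≤ _ := by
        gcongr
        exact mul_le_of_le_one_right' ENNReal.div_self_le_one

lemma rpow_le_tsum_dyadic {a : ℝ} (ha : 0 < a) (v : ℝ≥0∞) :
    v ^ a ≤ ∑' k : ℤ, {w : ℝ≥0∞ | 2 * 2 ^ k < w}.indicator (fun _ => (4 * 2 ^ k) ^ a) v := by
  rcases eq_or_ne v 0 with rfl | hv0
  · simp [ENNReal.zero_rpow_of_pos ha]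
  rcases eq_or_ne v ⊤ with rfl | hvt
  · have hlt : ∀ k : ℤ, (2 * 2 ^ k : ℝ≥0∞) < ⊤ := fun k =>
      ENNReal.mul_lt_top (by simp) (ENNReal.zpow_lt_top (by simp) (by simp) k)
    refine le_trans ?_ (ENNReal.tsum_comp_le_tsum_of_injective Nat.cast_injective _)
    refine le_trans ?_ (ENNReal.tsum_le_tsum (f := fun _ : ℕ => (1 : ℝ≥0∞)) fun n => ?_)
    · rw [ENNReal.tsum_const_eq_top_of_ne_zero one_ne_zero]
      exact le_top
    · rw [Set.indicator_of_mem (by exact hlt _)]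
      refine ENNReal.one_le_rpow ?_ ha
      rw [zpow_natCast]
      exact one_le_mul (by norm_num) (one_le_pow₀ (by norm_num))
  · obtain ⟨n, hn1, hn2⟩ := ENNReal.exists_mem_Ioc_zpow (x := v / 2) (y := 2)
      (by simpa using hv0) (ENNReal.div_ne_top hvt (by simp)) (by norm_num) (by simp)
    have h1 : 2 * 2 ^ n < v := by
      rw [mul_comm]
      exact (ENNReal.lt_div_iff_mul_lt (by simp) (by simp)).1 hn1
    have h2 : v ≤ 4 * 2 ^ n := by
      have := (ENNReal.div_le_iff_le_mul (by simp) (by simp)).1 hn2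
      rw [ENNReal.zpow_add (by simp) (by simp), zpow_one] at this
      calc v ≤ _ := this
        _ = 4 * 2 ^ n := by ring
    refine le_trans ?_ (ENNReal.le_tsum n)
    rw [Set.indicator_of_mem (by exact h1)]
    exact ENNReal.rpow_le_rpow h2 ha.le

lemma tsum_dyadic_rpow_le {b : ℝ} (hb : 0 < b) {v : ℝ≥0∞} (hv : v ≠ ⊤) :
    ∑' k : ℤ, {w : ℝ≥0∞ | 2 ^ k < w}.indicator (fun _ => (2 ^ k) ^ b) v ≤
      (1 - 2 ^ (-b))⁻¹ * v ^ b := by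
  rcases eq_or_ne v 0 with rfl | hv0
  · simp
  obtain ⟨n, hn1, hn2⟩ := ENNReal.exists_mem_Ioc_zpow hv0 hv (y := 2) (by norm_num) (by simp)
  have hinj : Function.Injective fun m : ℕ => n - (m : ℤ) := fun m m' h => by
    simp only at h; omega
  rw [← hinj.tsum_eq]
  · rw [← ENNReal.tsum_geometric, ← ENNReal.tsum_mul_right]
    refine ENNReal.tsum_le_tsum fun m => ?_
    refine (Set.indicator_le_self _ _ _).trans ?_
    rw [sub_eq_neg_add, ENNReal.zpow_add (by simp) (by simp),
      ENNReal.mul_rpow_of_nonneg _ _ hb.le]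
    gcongr
    rw [← ENNReal.rpow_intCast, ← ENNReal.rpow_mul, ← ENNReal.rpow_natCast, ← ENNReal.rpow_mul]
    apply le_of_eq
    congr 1
    push_cast
    ring
  · intro k hk
    have hkv : (2 : ℝ≥0∞) ^ k < v := by
      by_contra h
      exact hk (Set.indicator_of_notMem (s := {w : ℝ≥0∞ | 2 ^ k < w}) h _)
    have hkn : k ≤ n := by
      by_contra! h
      have := ENNReal.zpow_le_of_le (x := 2) (by norm_num) (show n + 1 ≤ k by omega)
      exact absurd (hkv.trans_le (hn2.trans this)) (lt_irrefl _)
    exact ⟨(n - k).toNat, by simp only; omega⟩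

/-- The strong type `(a,a)` estimate for the maximal function, for `a > 1`. -/
lemma exists_lintegral_hlMax_rpow_le [BorelSpace X] [TopologicalSpace.SeparableSpace X]
    {c_Q Q : ℝ} (hdim : DimLowerBound μ c_Q Q) (hcQ : 0 < c_Q) (hQ : 0 ≤ Q)
    (hpos : ∀ (x : X) (r : ℝ), 0 < r → μ (ball x r) ≠ 0)
    (hfin : ∀ (x : X) (r : ℝ), μ (ball x r) ≠ ⊤) {a : ℝ} (ha : 1 < a) :
    ∃ C : ℝ≥0∞, C ≠ ⊤ ∧ ∀ f : X → ℝ≥0∞, Measurable f → (∀ x, f x ≠ ⊤) →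
      ∫⁻ x, hlMax μ f x ^ a ∂μ ≤ C * ∫⁻ x, f x ^ a ∂μ := by
  have hb : 0 < a - 1 := by linarith
  set W := ENNReal.ofReal (c_Q⁻¹ * 5 ^ Q) with hW
  set B : ℝ≥0∞ := (1 - 2 ^ (-(a - 1)))⁻¹ with hB
  have hBt : B ≠ ⊤ := by
    rw [hB, ENNReal.inv_ne_top]
    refine (tsub_pos_of_lt ?_).ne'
    exact ENNReal.rpow_lt_one_of_one_lt_of_neg (by norm_num) (by linarith)
  refine ⟨4 ^ a * W * B, ENNReal.mul_ne_top (ENNReal.mul_ne_top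
    (ENNReal.rpow_ne_top_of_nonneg (by linarith) (by simp)) ENNReal.ofReal_ne_top) hBt,
    fun f hf hft => ?_⟩
  have hMm : Measurable (hlMax μ f) := measurable_hlMax f
  have hlevel : ∀ k : ℤ, μ {x | 2 * 2 ^ k < hlMax μ f x} ≤
      (2 ^ k)⁻¹ * (W * ∫⁻ x, {y | 2 ^ k < f y}.indicator f x ∂μ) := by
    intro k
    have h0 : (2 : ℝ≥0∞) ^ k ≠ 0 := (ENNReal.zpow_pos (by simp) (by simp) k).ne'
    have ht : (2 : ℝ≥0∞) ^ k ≠ ⊤ := (ENNReal.zpow_lt_top (by simp) (by simp) k).ne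
    rw [← ENNReal.mul_le_iff_le_inv h0 ht]
    refine le_trans ?_ (mul_measure_lt_hlMax_le hdim hcQ hQ hpos hfin _ (2 ^ k))
    refine mul_le_mul_right (measure_mono fun x hx => ?_) _
    have h := hx.trans_le (hlMax_le_hlMax_indicator_add f (2 ^ k) x)
    rw [two_mul] at h
    exact lt_of_add_lt_add_right h
  have hfind : ∀ k : ℤ, Measurable ({y | 2 ^ k < f y}.indicator f) := fun k =>
    hf.indicator (measurableSet_lt measurable_const hf)
  have hset : ∀ k : ℤ, MeasurableSet {w : ℝ≥0∞ | 2 * 2 ^ k < w} := fun k => measurableSet_Ioi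
  calc ∫⁻ x, hlMax μ f x ^ a ∂μ
      ≤ ∫⁻ x, ∑' k : ℤ, {w : ℝ≥0∞ | 2 * 2 ^ k < w}.indicator (fun _ => (4 * 2 ^ k) ^ a)
          (hlMax μ f x) ∂μ := lintegral_mono fun x => rpow_le_tsum_dyadic (by linarith) _
    _ = ∑' k : ℤ, (4 * 2 ^ k) ^ a * μ {x | 2 * 2 ^ k < hlMax μ f x} := by
        rw [lintegral_tsum fun k => by
          exact ((measurable_const.indicator (hset k)).comp hMm).aemeasurable]
        congr 1 with k
        exact lintegral_indicator_const (hMm (hset k)) _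
    _ ≤ ∑' k : ℤ, (4 * 2 ^ k) ^ a *
          ((2 ^ k)⁻¹ * (W * ∫⁻ x, {y | 2 ^ k < f y}.indicator f x ∂μ)) := by
        gcongr with k
        exact hlevel k
    _ = 4 ^ a * W * ∑' k : ℤ, ∫⁻ x, (2 ^ k) ^ (a - 1) * {y | 2 ^ k < f y}.indicator f x ∂μ := by
        rw [← ENNReal.tsum_mul_left]
        congr 1 with k
        have h0 : (2 : ℝ≥0∞) ^ k ≠ 0 := (ENNReal.zpow_pos (by simp) (by simp) k).ne'
        have ht : (2 : ℝ≥0∞) ^ k ≠ ⊤ := (ENNReal.zpow_lt_top (by simp) (by simp) k).ne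
        rw [lintegral_const_mul _ (hfind k),
          ENNReal.mul_rpow_of_nonneg _ _ (by linarith), ENNReal.rpow_sub _ _ h0 ht,
          ENNReal.rpow_one, div_eq_mul_inv]
        ring
    _ = 4 ^ a * W * ∫⁻ x, f x *
          ∑' k : ℤ, {w : ℝ≥0∞ | 2 ^ k < w}.indicator (fun _ => (2 ^ k) ^ (a - 1)) (f x) ∂μ := by
        rw [← lintegral_tsum fun k =>
          ((hfind k).const_mul _).aemeasurable]
        congr 2 with x
        rw [← ENNReal.tsum_mul_left]
        congr 1 with k
        by_cases h : 2 ^ k < f x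
        · simp [h, mul_comm]
        · simp [h]
    _ ≤ 4 ^ a * W * ∫⁻ x, B * f x ^ a ∂μ := by
        refine mul_le_mul_right (lintegral_mono fun x => ?_) _
        refine (mul_le_mul_right (tsum_dyadic_rpow_le hb (hft x)) _).trans (le_of_eq ?_)
        rcases eq_or_ne (f x) 0 with h | h
        · simp [h, ENNReal.zero_rpow_of_pos (by linarith : 0 < a)]
        · have hpow : f x ^ a = f x * f x ^ (a - 1) := by
            conv_lhs => rw [← add_sub_cancel 1 a, ENNReal.rpow_add _ _ h (hft x), ENNReal.rpow_one]
          rw [hpow]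
          ring
    _ = _ := by rw [lintegral_const_mul _ (hf.pow_const a), ← mul_assoc]

end MaximalFunction

lemma DiscreteMaxData.separableSpace [PseudoMetricSpace X] (D : DiscreteMaxData X) :
    TopologicalSpace.SeparableSpace X := by
  refine ⟨Set.range fun a : ℚ × ℕ => D.center a.1 a.2, Set.countable_range _, ?_⟩
  refine Metric.dense_iff.2 fun x ε hε => ?_
  obtain ⟨r, hr0, hr⟩ := exists_rat_btwn hε
  obtain ⟨i, hi⟩ := D.cover r (by exact_mod_cast hr0) x
  exact ⟨D.center r i, ball_subset_ball hr.le (mem_ball_comm.1 hi), ⟨(r, i), rfl⟩⟩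

/-- If one ball has infinite measure, then all of them do. -/
lemma DimLowerBound.measure_ball_eq_top [PseudoMetricSpace X] [MeasurableSpace X]
    {μ : Measure X} {c_Q Q : ℝ} (hdim : DimLowerBound μ c_Q Q) (hcQ : 0 < c_Q)
    {x₀ : X} {r₀ : ℝ} (h : μ (ball x₀ r₀) = ⊤) (y : X) {r : ℝ} (hr : 0 < r) :
    μ (ball y r) = ⊤ := by
  set R := max (max r₀ r) (dist y x₀ + 1) with hR
  have hrR : r ≤ R := (le_max_right _ _).trans (le_max_left _ _)
  have hR0 : 0 < R := hr.trans_le hrR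
  have hy : y ∈ ball x₀ R := by
    rw [mem_ball]
    exact (lt_add_one _).trans_le (le_max_right _ _)
  have hbig : μ (ball x₀ R) = ⊤ := by
    rw [eq_top_iff, ← h]
    exact measure_mono (ball_subset_ball ((le_max_left _ _).trans (le_max_left _ _)))
  have := hdim x₀ y r R hr hrR hy
  rwa [hbig, ENNReal.mul_top (by rw [Ne, ENNReal.ofReal_eq_zero, not_le]; positivity),
    top_le_iff] at this

lemma DiscreteMaxData.dMax_eq_zero [PseudoMetricSpace X] [MeasurableSpace X]
    (D : DiscreteMaxData X) {μ : Measure X}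
    (h : ∀ (x : X) (r : ℝ), 0 < r → μ (ball x r) = ⊤) (α : ℝ) (u : X → ℝ) (x : X) :
    D.dMax μ α u x = 0 := by
  simp only [DiscreteMaxData.dMax, ENNReal.iSup_eq_zero]
  intro r hr
  have hr' : (0 : ℝ) < r := by exact_mod_cast hr
  simp [setLAverage_eq, h _ (3 * (r : ℝ)) (by positivity)]

lemma hajlaszNorm_zero [PseudoMetricSpace X] [MeasurableSpace X] (μ : Measure X) (s p : ℝ) :
    hajlaszNorm μ s p (fun _ => 0) = 0 := by
  refine le_antisymm (iInf₂_le_of_le (fun _ => 0) ?_ (by simp)) zero_le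
  exact ⟨measurable_const, fun _ => le_rfl, ∅, measure_empty, by simp⟩

lemma eLpNorm_ofReal_eq [MeasurableSpace X] {μ : Measure X} {g : X → ℝ} (hg : ∀ x, 0 ≤ g x) {p : ℝ}
    (hp : 0 < p) :
    eLpNorm g (ENNReal.ofReal p) μ = (∫⁻ x, ENNReal.ofReal (g x ^ p) ∂μ) ^ (1 / p) := by
  rw [eLpNorm_eq_lintegral_rpow_enorm_toReal (by simpa using hp) (by simp),
    ENNReal.toReal_ofReal hp.le]
  congr 2 with x
  rw [Real.enorm_eq_ofReal (hg x), ENNReal.ofReal_rpow_of_nonneg (hg x) hp.le]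

section HedbergBound

variable [MetricSpace X] [MeasurableSpace X] {μ : Measure X}

/-- The function bounding the fractional maximal function of `g`, interpolating between the
Hardy–Littlewood maximal function and the `L^p` norm. -/
noncomputable def hedberg (μ : Measure X) (t p θ : ℝ) (g : X → ℝ) (x : X) : ℝ≥0∞ :=
  eLpNorm g (ENNReal.ofReal p) μ ^ θ *
    hlMax μ (fun y => ENNReal.ofReal (g y ^ t)) x ^ ((1 - θ) / t)

lemma measurable_hedberg [BorelSpace X] (t p θ : ℝ) (g : X → ℝ) :
    Measurable (hedberg μ t p θ g) :=
  ((measurable_hlMax _).pow_const _).const_mul _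

lemma laverage_rpow_mul_measure_rpow_le {g : X → ℝ} (hgm : Measurable g) (hg : ∀ x, 0 ≤ g x)
    {t p : ℝ} (ht : 0 < t) (htp : t ≤ p) {z : X} {ρ : ℝ} (h0 : μ (ball z ρ) ≠ 0)
    (htop : μ (ball z ρ) ≠ ⊤) :
    (⨍⁻ y in ball z ρ, ENNReal.ofReal (g y ^ t) ∂μ) ^ (1 / t) * μ (ball z ρ) ^ (1 / p) ≤
      eLpNorm g (ENNReal.ofReal p) μ := by
  have hp : 0 < p := ht.trans_le htp
  set m := μ (ball z ρ) with hm
  have hm' : m ^ (1 / t - 1 / p) ≠ 0 := (ENNReal.rpow_pos (pos_iff_ne_zero.2 h0) htop).ne'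
  have hmt : m ^ (1 / t - 1 / p) ≠ ⊤ := ENNReal.rpow_ne_top_of_ne_zero h0 htop
  have h := eLpNorm_le_eLpNorm_mul_rpow_measure_univ (μ := μ.restrict (ball z ρ))
    (ENNReal.ofReal_le_ofReal htp) hgm.aestronglyMeasurable
  rw [eLpNorm_ofReal_eq hg ht, Measure.restrict_apply_univ, ENNReal.toReal_ofReal ht.le,
    ENNReal.toReal_ofReal hp.le] at h
  refine (ENNReal.mul_le_mul_iff_left hm' hmt).1 (le_trans (le_of_eq ?_)
    (h.trans (mul_le_mul_left (eLpNorm_mono_measure _ Measure.restrict_le_self) _)))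
  rw [mul_assoc, ← ENNReal.rpow_add _ _ h0 htop, add_sub_cancel,
    ← ENNReal.mul_rpow_of_nonneg _ _ (by positivity), setLAverage_eq,
    ENNReal.div_mul_cancel h0 htop]

/-- Hedberg's pointwise estimate. -/
lemma ofReal_rpow_mul_laverage_rpow_le {Q c_l : ℝ} (hQ : 0 < Q) (hcl : 0 < c_l)
    (hlow : ∀ (x : X) (r : ℝ), 0 < r → ENNReal.ofReal (c_l * r ^ Q) ≤ μ (ball x r))
    (hfin : ∀ (x : X) (r : ℝ), μ (ball x r) ≠ ⊤) {g : X → ℝ} (hgm : Measurable g)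
    (hg : ∀ x, 0 ≤ g x) {t p β : ℝ} (ht : 0 < t) (htp : t ≤ p) (hβ : 0 ≤ β) (hβp : β * p ≤ Q)
    {x : X} {ρ : ℝ} (hρ : 0 < ρ) :
    ENNReal.ofReal (ρ ^ β) * (⨍⁻ y in ball x ρ, ENNReal.ofReal (g y ^ t) ∂μ) ^ (1 / t) ≤
      ENNReal.ofReal (c_l ^ (-(β / Q))) * hedberg μ t p (β * p / Q) g x := by
  have hp : 0 < p := ht.trans_le htp
  set θ := β * p / Q with hθ
  have hθ0 : 0 ≤ θ := by positivity
  have hθ1 : θ ≤ 1 := (div_le_one hQ).2 hβp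
  set f : X → ℝ≥0∞ := fun y => ENNReal.ofReal (g y ^ t)
  set m := μ (ball x ρ) with hm
  set A := ⨍⁻ y in ball x ρ, f y ∂μ with hA
  have h0 : m ≠ 0 := by
    refine (lt_of_lt_of_le ?_ (hlow x ρ hρ)).ne'
    rw [ENNReal.ofReal_pos]
    positivity
  have hAm : A ^ (1 / t) * m ^ (1 / p) ≤ eLpNorm g (ENNReal.ofReal p) μ :=
    laverage_rpow_mul_measure_rpow_le hgm hg ht htp h0 (hfin x ρ)
  have hAM : A ≤ hlMax μ f x := laverage_le_hlMax f (mem_ball_self hρ)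
  have hρm : ENNReal.ofReal (ρ ^ β) ≤ ENNReal.ofReal (c_l ^ (-(β / Q))) * (m ^ (1 / p)) ^ θ := by
    have e1 : ρ ^ β = c_l ^ (-(β / Q)) * (c_l * ρ ^ Q) ^ (β / Q) := by
      rw [Real.mul_rpow hcl.le (by positivity), ← mul_assoc, ← Real.rpow_add hcl,
        neg_add_cancel, Real.rpow_zero, one_mul, ← Real.rpow_mul hρ.le, mul_div_cancel₀ _ hQ.ne']
    have e2 : 1 / p * θ = β / Q := by rw [hθ]; field_simp
    rw [e1, ENNReal.ofReal_mul (by positivity), ← ENNReal.rpow_mul, e2,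
      ← ENNReal.ofReal_rpow_of_nonneg (p := β / Q) (x := c_l * ρ ^ Q) (by positivity)
        (by positivity)]
    gcongr
    exact hlow x ρ hρ
  have hsplit : A ^ (1 / t) = (A ^ (1 / t)) ^ θ * A ^ ((1 - θ) / t) := by
    rw [← ENNReal.rpow_mul, ← ENNReal.rpow_add_of_nonneg _ _ (by positivity)
      (div_nonneg (by linarith) ht.le)]
    congr 1
    field_simp
    ring
  calc ENNReal.ofReal (ρ ^ β) * A ^ (1 / t)
      ≤ ENNReal.ofReal (c_l ^ (-(β / Q))) * (m ^ (1 / p)) ^ θ *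
          ((A ^ (1 / t)) ^ θ * A ^ ((1 - θ) / t)) := by rw [← hsplit]; gcongr
    _ = ENNReal.ofReal (c_l ^ (-(β / Q))) *
          ((A ^ (1 / t) * m ^ (1 / p)) ^ θ * A ^ ((1 - θ) / t)) := by
        rw [ENNReal.mul_rpow_of_nonneg _ _ hθ0]; ring
    _ ≤ _ := by
        unfold hedberg
        have : 0 ≤ (1 - θ) / t := div_nonneg (by linarith) ht.le
        gcongr

lemma eLpNorm_hedberg_le {C : ℝ≥0∞} {t p θ : ℝ} (ht : 0 < t) (hp : 0 < p) (hθ0 : 0 ≤ θ)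
    (hθ1 : θ < 1) [BorelSpace X] {g : X → ℝ} (hg : ∀ x, 0 ≤ g x)
    (hmax : ∫⁻ x, hlMax μ (fun y => ENNReal.ofReal (g y ^ t)) x ^ (p / t) ∂μ ≤
      C * ∫⁻ x, ENNReal.ofReal (g x ^ t) ^ (p / t) ∂μ) :
    eLpNorm (hedberg μ t p θ g) (ENNReal.ofReal (p / (1 - θ))) μ ≤
      C ^ (1 / (p / (1 - θ))) * eLpNorm g (ENNReal.ofReal p) μ := by
  have hθ : 0 < 1 - θ := by linarith
  set q := p / (1 - θ) with hq_def
  have hq : 0 < q := by positivity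
  have hf : ∀ x, ENNReal.ofReal (g x ^ t) ^ (p / t) = ENNReal.ofReal (g x ^ p) := fun x => by
    rw [ENNReal.ofReal_rpow_of_nonneg (Real.rpow_nonneg (hg x) _) (by positivity),
      ← Real.rpow_mul (hg x), mul_div_cancel₀ _ ht.ne']
  simp only [hf] at hmax
  set G := eLpNorm g (ENNReal.ofReal p) μ with hG
  have hGp : ∫⁻ x, ENNReal.ofReal (g x ^ p) ∂μ = G ^ p := by
    rw [hG, eLpNorm_ofReal_eq hg hp, ← ENNReal.rpow_mul, one_div_mul_cancel hp.ne',
      ENNReal.rpow_one]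
  rw [eLpNorm_eq_lintegral_rpow_enorm_toReal (by simpa using hq) (by simp),
    ENNReal.toReal_ofReal hq.le]
  have hpow : ∀ x, ‖hedberg μ t p θ g x‖ₑ ^ q =
      (G ^ θ) ^ q * hlMax μ (fun y => ENNReal.ofReal (g y ^ t)) x ^ (p / t) := fun x => by
    rw [enorm_eq_self, hedberg, ENNReal.mul_rpow_of_nonneg _ _ hq.le, ← ENNReal.rpow_mul _ _ q,
      ← ENNReal.rpow_mul _ _ q]
    congr 2
    rw [hq_def]
    field_simp
  simp only [hpow]
  rw [lintegral_const_mul _ ((measurable_hlMax _).pow_const _)]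
  calc ((G ^ θ) ^ q * ∫⁻ x, hlMax μ (fun y => ENNReal.ofReal (g y ^ t)) x ^ (p / t) ∂μ) ^ (1 / q)
      ≤ ((G ^ θ) ^ q * (C * G ^ p)) ^ (1 / q) := by
        rw [← hGp]
        gcongr
    _ = G ^ θ * (C ^ (1 / q) * G ^ (1 - θ)) := by
        rw [ENNReal.mul_rpow_of_nonneg _ _ (by positivity),
          ENNReal.mul_rpow_of_nonneg _ _ (by positivity), ← ENNReal.rpow_mul _ q,
          mul_one_div_cancel hq.ne', ENNReal.rpow_one, ← ENNReal.rpow_mul G p]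
        congr 3
        rw [hq_def]
        field_simp
    _ = C ^ (1 / q) * (G ^ θ * G ^ (1 - θ)) := by ring
    _ = C ^ (1 / q) * G := by
        rw [← ENNReal.rpow_add_of_nonneg _ _ hθ0 hθ.le, add_sub_cancel, ENNReal.rpow_one]

end HedbergBound

section Gradient

variable [MetricSpace X] [MeasurableSpace X] {μ : Measure X}

/-- The discrete maximal function satisfies a Lipschitz-type estimate at `x` whose constant is
controlled by `hedberg` at `x`. -/
lemma exists_dMax_le_dMax_add [BorelSpace X] {Q c_Q c_l s α p : ℝ} (hQ : 0 < Q) (hcQ : 0 < c_Q)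
    (hdim : DimLowerBound μ c_Q Q) (hcl : 0 < c_l)
    (hlow : ∀ (x : X) (r : ℝ), 0 < r → ENNReal.ofReal (c_l * r ^ Q) ≤ μ (ball x r))
    (hfin : ∀ (x : X) (r : ℝ), μ (ball x r) ≠ ⊤) (D : DiscreteMaxData X) (hs : 0 ≤ s)
    (hα : 0 ≤ α) (hβ : 0 ≤ s + α - 1) (hβp : (s + α - 1) * p ≤ Q) (hp : Q / (Q + s) ≤ p) :
    ∃ C : ℝ, 0 < C ∧ ∀ u g : X → ℝ, AEStronglyMeasurable u μ → IsHajlaszGradient μ s u g →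
      ∀ (x : X) (K : ℝ), 0 < K →
        hedberg μ (Q / (Q + s)) p ((s + α - 1) * p / Q) g x ≤ ENNReal.ofReal K →
        ∀ y, D.dMax μ α u x ≤ D.dMax μ α u y + ENNReal.ofReal (C * (K * dist x y)) := by
  have hpos : ∀ (x : X) (r : ℝ), 0 < r → μ (ball x r) ≠ 0 := fun x r hr =>
    ((ENNReal.ofReal_pos.2 (by positivity)).trans_le (hlow x r hr)).ne'
  obtain ⟨C₀, hC₀, hpoin⟩ := exists_const_lintegral_sub_le hdim hcQ hQ hpos hfin hs
  have ht : 0 < Q / (Q + s) := by positivity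
  set t := Q / (Q + s) with ht_def
  set β := s + α - 1 with hβ_def
  set C₁ := c_l ^ (-(β / Q)) with hC₁_def
  have hC₁ : 0 < C₁ := by positivity
  set B := c_Q⁻¹ * 10 ^ Q with hB_def
  have hB : 0 < B := by positivity
  have hL := D.L_pos
  refine ⟨(20 * D.N * D.L + 70) * (2 * (B * (C₀ * C₁))), by positivity,
    fun u g hu hg x K hK hxK y => ?_⟩
  have hlocal : ∀ R : ℝ, 0 < R → ∃ c : ℝ, ∫⁻ y in ball x R, ‖u y - c‖ₑ ∂μ ≤
      ENNReal.ofReal (C₀ * C₁ * K * R ^ (1 - α)) * μ (ball x R) := by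
    intro R hR
    have hA : ⨍⁻ y in ball x (2 * R), ENNReal.ofReal (g y ^ t) ∂μ ≤
        ENNReal.ofReal ((C₁ * K * R ^ (-β)) ^ t) := by
      have h1 : ENNReal.ofReal (R ^ β) *
          (⨍⁻ y in ball x (2 * R), ENNReal.ofReal (g y ^ t) ∂μ) ^ (1 / t) ≤
          ENNReal.ofReal (C₁ * K) := by
        calc _ ≤ ENNReal.ofReal ((2 * R) ^ β) *
              (⨍⁻ y in ball x (2 * R), ENNReal.ofReal (g y ^ t) ∂μ) ^ (1 / t) := by
              gcongr
              linarith
          _ ≤ ENNReal.ofReal C₁ * hedberg μ t p (β * p / Q) g x :=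
              ofReal_rpow_mul_laverage_rpow_le hQ hcl hlow hfin hg.1 hg.2.1 ht hp hβ hβp
                (by positivity)
          _ ≤ ENNReal.ofReal C₁ * ENNReal.ofReal K := by gcongr
          _ = _ := (ENNReal.ofReal_mul hC₁.le).symm
      set a := ⨍⁻ y in ball x (2 * R), ENNReal.ofReal (g y ^ t) ∂μ with ha
      have h2 : a ^ (1 / t) ≤ ENNReal.ofReal (C₁ * K * R ^ (-β)) := by
        calc a ^ (1 / t) = ENNReal.ofReal (R ^ (-β)) * (ENNReal.ofReal (R ^ β) * a ^ (1 / t)) := by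
              rw [← mul_assoc, ← ENNReal.ofReal_mul (by positivity), ← Real.rpow_add hR,
                neg_add_cancel, Real.rpow_zero, ENNReal.ofReal_one, one_mul]
          _ ≤ ENNReal.ofReal (R ^ (-β)) * ENNReal.ofReal (C₁ * K) := by gcongr
          _ = _ := by rw [← ENNReal.ofReal_mul (by positivity), mul_comm]
      calc a = (a ^ (1 / t)) ^ t := by
            rw [← ENNReal.rpow_mul, one_div_mul_cancel ht.ne', ENNReal.rpow_one]
        _ ≤ ENNReal.ofReal (C₁ * K * R ^ (-β)) ^ t := by gcongr
        _ = _ := ENNReal.ofReal_rpow_of_nonneg (by positivity) ht.le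
    obtain ⟨c, hc⟩ := hpoin u g hg x R ((C₁ * K * R ^ (-β)) ^ t) hR (by positivity) (by
      rw [← measure_mul_setLAverage _ (hfin x _), mul_comm]
      gcongr)
    refine ⟨c, hc.trans_eq ?_⟩
    rw [← Real.rpow_mul (by positivity), mul_inv_cancel₀ ht.ne', Real.rpow_one,
      show 1 - α = s + -β by rw [hβ_def]; ring, Real.rpow_add hR]
    congr 2
    ring
  have hnn : ∀ R : ℝ, 0 < R → 0 ≤ C₀ * C₁ * K * R ^ (1 - α) := fun R hR => by positivity
  have hmain := D.dMax_le_dMax_add μ (u := u) (x := x) (K := 2 * (B * (C₀ * C₁ * K))) hα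
    (by positivity) ?_ ?_ y
  · refine hmain.trans_eq ?_
    congr 2
    ring
  · intro z ρ hρ hz
    obtain ⟨c, hc⟩ := hlocal (10 * ρ) (by positivity)
    exact (abs_laverage_sub_abs_le hdim hcQ hQ.le hpos hfin hu (hnn _ (by positivity)) hc hρ
      (by linarith) le_rfl).1
  · intro z ρ z' ρ' R hρ hzR hR hρ' hzR' hR'
    have hR0 : 0 < R := by linarith [dist_nonneg (x := z) (y := x)]
    obtain ⟨c, hc⟩ := hlocal R hR0
    have h1 := (abs_laverage_sub_abs_le hdim hcQ hQ.le hpos hfin hu (hnn R hR0) hc hρ hzR hR).2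
    have h2 := (abs_laverage_sub_abs_le hdim hcQ hQ.le hpos hfin hu (hnn R hR0) hc hρ' hzR' hR').2
    rw [abs_sub_comm] at h2
    refine (abs_sub_le _ (abs c) _).trans ((add_le_add h1 h2).trans_eq ?_)
    ring

lemma isHajlaszGradient_one_toReal {v w : X → ℝ≥0∞} {C : ℝ} (hC : 0 ≤ C) (hw : Measurable w)
    (hw_top : ∀ᵐ x ∂μ, w x ≠ ⊤) (hv : ∃ x, v x ≠ ⊤)
    (h : ∀ (x : X) (K : ℝ), 0 < K → w x ≤ ENNReal.ofReal K →
      ∀ y, v x ≤ v y + ENNReal.ofReal (C * (K * dist x y))) :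
    IsHajlaszGradient μ 1 (fun x => (v x).toReal) (fun x => C * (w x).toReal) := by
  refine ⟨hw.ennreal_toReal.const_mul C, fun x => by positivity, {x | ¬ w x ≠ ⊤}, hw_top, ?_⟩
  have hK : ∀ x, w x ≠ ⊤ → ∀ ε : ℝ, 0 < ε →
      ∀ y, v x ≤ v y + ENNReal.ofReal (C * (((w x).toReal + ε) * dist x y)) :=
    fun x hx ε hε => h x _ (by positivity) (by
      rw [ENNReal.ofReal_add (by positivity) hε.le, ENNReal.ofReal_toReal hx]
      exact le_self_add)
  obtain ⟨x₀, hx₀⟩ := hv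
  have hfin : ∀ x, w x ≠ ⊤ → v x ≠ ⊤ := fun x hx =>
    ne_top_of_le_ne_top (by finiteness) (hK x hx 1 one_pos x₀)
  have key : ∀ x y, w x ≠ ⊤ → w y ≠ ⊤ →
      (v x).toReal - (v y).toReal ≤ C * ((w x).toReal * dist x y) := by
    intro x y hx hy
    have hlim : Filter.Tendsto (fun ε : ℝ => C * (((w x).toReal + ε) * dist x y))
        (nhdsWithin 0 (Set.Ioi 0)) (nhds (C * (((w x).toReal + 0) * dist x y))) :=
      Filter.Tendsto.mono_left (Continuous.tendsto (by fun_prop) 0) nhdsWithin_le_nhds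
    rw [add_zero] at hlim
    refine ge_of_tendsto hlim (Filter.eventually_of_mem self_mem_nhdsWithin fun ε hε => ?_)
    have hε' : 0 < ε := hε
    have h1 := ENNReal.toReal_mono (by finiteness [hfin y hy]) (hK x hx ε hε y)
    rw [ENNReal.toReal_add (hfin y hy) (by simp), ENNReal.toReal_ofReal (by positivity)] at h1
    linarith
  intro x hx y hy
  have hx' : w x ≠ ⊤ := by simpa using hx
  have hy' : w y ≠ ⊤ := by simpa using hy
  have h1 := key x y hx' hy'
  have h2 := key y x hy' hx'
  have h3 : 0 ≤ C * ((w x).toReal * dist x y) := by positivity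
  have h4 : 0 ≤ C * ((w y).toReal * dist x y) := by positivity
  rw [dist_comm] at h2
  rw [Real.rpow_one, abs_sub_le_iff]
  constructor <;> nlinarith

end Gradient

theorem statement10 [MetricSpace X] [MeasurableSpace X] [BorelSpace X] (μ : Measure X)
    (c_d : ℝ≥0∞) (hdoub : IsDoubling μ c_d) (Q : ℝ) (hQ : 1 < Q)
    (c_Q : ℝ) (hcQ : 0 < c_Q) (hdim : DimLowerBound μ c_Q Q)
    (c_l : ℝ) (hcl : 0 < c_l)
    (hlow : ∀ (x : X) (r : ℝ), 0 < r → ENNReal.ofReal (c_l * r ^ Q) ≤ μ (ball x r))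
    (D : DiscreteMaxData X)
    (s α p : ℝ) (hs : 0 ≤ s) (hα : 0 ≤ α)
    (hsα0 : 1 < s + α) (hsα1 : s + α ≤ 1 + Q / p) (hp : Q / (Q + s) < p) :
    ∃ C : ℝ, 0 < C ∧ ∀ u : X → ℝ, LocallyIntegrable u μ →
      hajlaszNorm μ s p u ≠ ⊤ → (∃ x, D.dMax μ α u x ≠ ⊤) →
      hajlaszNorm μ 1 (Q * p / (Q - (s + α - 1) * p)) (fun x => (D.dMax μ α u x).toReal) ≤
        ENNReal.ofReal C * hajlaszNorm μ s p u := by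
  by_cases hfin : ∀ (x : X) (r : ℝ), μ (ball x r) ≠ ⊤
  swap
  · push Not at hfin
    obtain ⟨x₀, r₀, h⟩ := hfin
    refine ⟨1, one_pos, fun u _ _ _ => ?_⟩
    simp [D.dMax_eq_zero (fun x r hr => hdim.measure_ball_eq_top hcQ h x hr), hajlaszNorm_zero]
  have hQ0 : 0 < Q := one_pos.trans hQ
  have ht : 0 < Q / (Q + s) := by positivity
  have hp0 : 0 < p := ht.trans hp
  have hβp : (s + α - 1) * p ≤ Q := by
    rw [← le_div_iff₀ hp0]
    linarith
  have hpos : ∀ (x : X) (r : ℝ), 0 < r → μ (ball x r) ≠ 0 := fun x r hr =>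
    ((ENNReal.ofReal_pos.2 (by positivity)).trans_le (hlow x r hr)).ne'
  have := D.separableSpace
  have := UniformSpace.secondCountable_of_separable X
  obtain ⟨C₃, hC₃, hdMax⟩ := exists_dMax_le_dMax_add hQ0 hcQ hdim hcl hlow hfin D hs hα
    (by linarith) hβp hp.le
  obtain ⟨C, hC, hmax⟩ := exists_lintegral_hlMax_rpow_le hdim hcQ hQ0.le hpos hfin
    ((one_lt_div ht).2 hp)
  set t := Q / (Q + s) with ht_def
  set θ := (s + α - 1) * p / Q with hθ_def
  have hθ0 : 0 ≤ θ := div_nonneg (mul_nonneg (by linarith) hp0.le) hQ0.le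
  set q := Q * p / (Q - (s + α - 1) * p) with hq_def
  have hq0 : 0 ≤ q := div_nonneg (by positivity) (by linarith)
  have hCq : C ^ (1 / q) ≠ ⊤ := ENNReal.rpow_ne_top_of_nonneg (by positivity) hC
  refine ⟨C₃ * (C ^ (1 / q)).toReal + 1, by positivity, fun u hu _ hx₀ => ?_⟩
  have hconst : ENNReal.ofReal C₃ * C ^ (1 / q) ≤
      ENNReal.ofReal (C₃ * (C ^ (1 / q)).toReal + 1) := by
    rw [← ENNReal.ofReal_toReal hCq, ← ENNReal.ofReal_mul hC₃.le, ENNReal.ofReal_toReal hCq]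
    exact ENNReal.ofReal_le_ofReal (by linarith)
  set C' := C₃ * (C ^ (1 / q)).toReal + 1 with hC'_def
  have hC' : ENNReal.ofReal C' ≠ 0 := by
    rw [Ne, ENNReal.ofReal_eq_zero, not_le]
    positivity
  simp only [hajlaszNorm.eq_def μ s, ENNReal.mul_iInf_of_ne hC' ENNReal.ofReal_ne_top]
  refine le_iInf₂ fun g hg => ?_
  obtain hG | hG := eq_or_ne (eLpNorm g (ENNReal.ofReal p) μ) ⊤
  · simp [hG, ENNReal.mul_top hC']
  have hmaxg := hmax (fun y => ENNReal.ofReal (g y ^ t)) (hg.1.pow_const t).ennreal_ofReal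
    (fun _ => ENNReal.ofReal_ne_top)
  have hfin_max : ∀ᵐ x ∂μ, hlMax μ (fun y => ENNReal.ofReal (g y ^ t)) x ≠ ⊤ := by
    have hgint : ∫⁻ x, ENNReal.ofReal (g x ^ t) ^ (p / t) ∂μ ≠ ⊤ := by
      have hf : ∀ x, ENNReal.ofReal (g x ^ t) ^ (p / t) = ENNReal.ofReal (g x ^ p) := fun x => by
        rw [ENNReal.ofReal_rpow_of_nonneg (Real.rpow_nonneg (hg.2.1 x) _) (by positivity),
          ← Real.rpow_mul (hg.2.1 x), mul_div_cancel₀ _ ht.ne']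
      simp only [hf]
      rw [eLpNorm_ofReal_eq hg.2.1 hp0] at hG
      intro htop
      simp [htop, hp0] at hG
    filter_upwards [ae_lt_top ((measurable_hlMax _).pow_const _)
      (ne_top_of_le_ne_top (ENNReal.mul_ne_top hC hgint) hmaxg)] with x hx htop
    rw [htop, ENNReal.top_rpow_of_pos (by positivity)] at hx
    exact lt_irrefl _ hx
  have hw_top : ∀ᵐ x ∂μ, hedberg μ t p θ g x ≠ ⊤ := by
    filter_upwards [hfin_max] with x hx
    have hθ1 : θ ≤ 1 := (div_le_one hQ0).2 hβp
    exact ENNReal.mul_ne_top (ENNReal.rpow_ne_top_of_nonneg hθ0 hG)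
      (ENNReal.rpow_ne_top_of_nonneg (div_nonneg (by linarith) ht.le) hx)
  refine (iInf₂_le _ (isHajlaszGradient_one_toReal hC₃.le (measurable_hedberg t p θ g) hw_top hx₀
    (hdMax u g hu.aestronglyMeasurable hg))).trans ?_
  obtain hend | hlt := hβp.eq_or_lt
  · have hq : q = 0 := by rw [hq_def, hend, sub_self, _root_.div_zero]
    simp [hq]
  have hθ1 : θ < 1 := (div_lt_one hQ0).2 hlt
  have hq : q = p / (1 - θ) := by
    have h1 : Q - (s + α - 1) * p ≠ 0 := by linarith
    have h2 : 1 - θ = (Q - (s + α - 1) * p) / Q := by rw [hθ_def]; field_simp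
    rw [h2, hq_def]
    field_simp
  calc eLpNorm (fun x => C₃ * (hedberg μ t p θ g x).toReal) (ENNReal.ofReal q) μ
      ≤ ENNReal.ofReal C₃ * eLpNorm (hedberg μ t p θ g) (ENNReal.ofReal q) μ := by
        have := eLpNorm_const_smul_le (c := C₃) (f := fun x => (hedberg μ t p θ g x).toReal)
          (p := ENNReal.ofReal q) (μ := μ)
        rw [Real.enorm_eq_ofReal hC₃.le] at this
        refine this.trans ?_
        gcongr
        refine eLpNorm_mono_enorm fun x => ?_
        rw [Real.enorm_eq_ofReal ENNReal.toReal_nonneg, enorm_eq_self]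
        exact ENNReal.ofReal_toReal_le
    _ ≤ ENNReal.ofReal C₃ * (C ^ (1 / q) * eLpNorm g (ENNReal.ofReal p) μ) := by
        rw [hq]
        gcongr
        exact eLpNorm_hedberg_le ht hp0 hθ0 hθ1 hg.2.1 hmaxg
    _ ≤ ENNReal.ofReal C' * eLpNorm g (ENNReal.ofReal p) μ := by
        rw [← mul_assoc]
        gcongr

end FracMaximal
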